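/- arXiv:1009.1939 — 3 statements merged into one kernel-verified Lean document; each statement's English description precedes it below -/
import Mathlib

section
/- In the partition algebra A_k(z) (k ≥ 2): for every i with 1 ≤ i ≤ k−1 one has σ_{i+1} p_{i+1/2} = p_{i+1/2}, and for every i with 1 ≤ i ≤ k−2 one has s_{i+1} σ_{i+1} p_{i+3/2} = p_{i+1/2} s_{i+1} σ_{i+1}. -/
open Polynomial

/-- Elements of an algebra over `R = ℤ[z]` (with `z = Polynomial.X`) satisfying the
defining relations of the partition algebra `A_k(z)` of Halverson–Ram.
Here `p i` stands for the generator `p_i` (for `1 ≤ i ≤ k`), `q i` stands for the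
half-integer generator `p_{i+1/2}` (for `1 ≤ i ≤ k-1`), and `s i` stands for `s_i`
(for `1 ≤ i ≤ k-1`). -/
structure PartitionAlgebra (k : ℕ) (A : Type*) [Ring A] [Algebra (Polynomial ℤ) A] where
  p : ℕ → A
  q : ℕ → A
  s : ℕ → A
  s_sq : ∀ i, 1 ≤ i → i ≤ k - 1 → s i * s i = 1
  s_comm : ∀ i j, 1 ≤ i → i ≤ k - 1 → 1 ≤ j → j ≤ k - 1 → j ≠ i + 1 → i ≠ j + 1 →
    s i * s j = s j * s i
  braid : ∀ i, 1 ≤ i → i + 1 ≤ k - 1 →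
    s i * s (i + 1) * s i = s (i + 1) * s i * s (i + 1)
  p_sq : ∀ i, 1 ≤ i → i ≤ k → p i * p i = (X : Polynomial ℤ) • p i
  q_sq : ∀ i, 1 ≤ i → i ≤ k - 1 → q i * q i = q i
  s_q : ∀ i, 1 ≤ i → i ≤ k - 1 → s i * q i = q i
  q_s : ∀ i, 1 ≤ i → i ≤ k - 1 → q i * s i = q i
  s_pp : ∀ i, 1 ≤ i → i ≤ k - 1 → s i * (p i * p (i + 1)) = p i * p (i + 1)
  pp_s : ∀ i, 1 ≤ i → i ≤ k - 1 → p i * p (i + 1) * s i = p i * p (i + 1)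
  p_comm : ∀ i j, 1 ≤ i → i ≤ k → 1 ≤ j → j ≤ k → p i * p j = p j * p i
  q_comm : ∀ i j, 1 ≤ i → i ≤ k - 1 → 1 ≤ j → j ≤ k - 1 → q i * q j = q j * q i
  q_p : ∀ i j, 1 ≤ i → i ≤ k - 1 → 1 ≤ j → j ≤ k → j ≠ i → j ≠ i + 1 →
    q i * p j = p j * q i
  s_p : ∀ i j, 1 ≤ i → i ≤ k - 1 → 1 ≤ j → j ≤ k → j ≠ i → j ≠ i + 1 →
    s i * p j = p j * s i
  s_q' : ∀ i j, 1 ≤ i → i ≤ k - 1 → 1 ≤ j → j ≤ k - 1 → j + 1 ≠ i → j ≠ i + 1 →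
    s i * q j = q j * s i
  sps : ∀ i, 1 ≤ i → i ≤ k - 1 → s i * p i * s i = p (i + 1)
  sqs : ∀ i, 2 ≤ i → i ≤ k - 1 →
    s i * q (i - 1) * s i = s (i - 1) * q i * s (i - 1)
  qpq₁ : ∀ i, 1 ≤ i → i ≤ k - 1 → q i * p i * q i = q i
  qpq₂ : ∀ i, 1 ≤ i → i ≤ k - 1 → q i * p (i + 1) * q i = q i
  pqp₁ : ∀ i, 2 ≤ i → i ≤ k → p i * q (i - 1) * p i = p i
  pqp₂ : ∀ i, 1 ≤ i → i ≤ k - 1 → p i * q i * p i = p i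

namespace PartitionAlgebra

variable {k : ℕ} {A : Type*} [Ring A] [Algebra (Polynomial ℤ) A]

/-- `(P.LS i).1 = L_i` and `(P.LS i).2 = σ_i` (with the junk value `σ_0 := 1`). -/
def LS (P : PartitionAlgebra k A) : ℕ → A × A
  | 0 => (0, 1)
  | 1 => (P.p 1, 1)
  | n + 2 =>
    let Lp := (P.LS (n + 1)).1
    let sp := (P.LS (n + 1)).2
    let Lpp := (P.LS n).1
    let snew : A :=
      if n = 0 then P.s 1
      else
        P.s n * P.s (n + 1) * sp * P.s (n + 1) * P.s n
          + P.s (n + 1) * P.q n * Lpp * P.s (n + 1) * P.q n * P.s (n + 1)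
          + P.q n * Lpp * P.s (n + 1) * P.q n
          - P.s (n + 1) * P.q n * Lpp * P.s n * P.q (n + 1) * P.p (n + 1) * P.q n
          - P.q n * P.p (n + 1) * P.q (n + 1) * P.s n * Lpp * P.q n * P.s (n + 1)
    (-(P.s (n + 1) * Lp * P.q (n + 1)) - P.q (n + 1) * Lp * P.s (n + 1)
        + P.q (n + 1) * Lp * P.p (n + 2) * P.q (n + 1)
        + P.s (n + 1) * Lp * P.s (n + 1) + snew,
      snew)

/-- The Jucys–Murphy element `L_i` of the partition algebra. -/
def L (P : PartitionAlgebra k A) (i : ℕ) : A := (P.LS i).1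

/-- The element `σ_i` of the partition algebra. -/
def sig (P : PartitionAlgebra k A) (i : ℕ) : A := (P.LS i).2

/-- `(P.LSh i).1 = L_{i+1/2}` and `(P.LSh i).2 = σ_{i+1/2}`. -/
def LSh (P : PartitionAlgebra k A) : ℕ → A × A
  | 0 => (0, 1)
  | 1 =>
    (-(P.L 1 * P.q 1) - P.q 1 * P.L 1 + P.q 1 * P.L 1 * P.p 1 * P.q 1
        + P.s 1 * (0 : A) * P.s 1 + 1, 1)
  | n + 2 =>
    let Lhp := (P.LSh (n + 1)).1
    let shp := (P.LSh (n + 1)).2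
    let snew : A :=
      P.s (n + 1) * P.s (n + 2) * shp * P.s (n + 2) * P.s (n + 1)
        + P.q (n + 1) * P.L (n + 1) * P.s (n + 2) * P.q (n + 1) * P.s (n + 2)
        + P.s (n + 2) * P.q (n + 1) * P.L (n + 1) * P.s (n + 2) * P.q (n + 1)
        - P.q (n + 1) * P.L (n + 1) * P.s (n + 1) * P.q (n + 2) * P.p (n + 2) * P.q (n + 1)
        - P.s (n + 2) * P.q (n + 1) * P.p (n + 2) * P.q (n + 2) * P.s (n + 1)
            * P.L (n + 1) * P.q (n + 1) * P.s (n + 2)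
    (-(P.L (n + 2) * P.q (n + 2)) - P.q (n + 2) * P.L (n + 2)
        + P.q (n + 2) * P.L (n + 2) * P.p (n + 2) * P.q (n + 2)
        + P.s (n + 2) * Lhp * P.s (n + 2) + snew,
      snew)

/-- The half-integer Jucys–Murphy element `L_{i+1/2}` of the partition algebra. -/
def Lh (P : PartitionAlgebra k A) (i : ℕ) : A := (P.LSh i).1

/-- The element `σ_{i+1/2}` of the partition algebra. -/
def sigH (P : PartitionAlgebra k A) (i : ℕ) : A := (P.LSh i).2

end PartitionAlgebra

namespace PartitionAlgebra

section Words

variable {A : Type*} [Ring A]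

/-- Multiplying the recursion for `σ_{i+2}` by `p_{i+3/2}` on the right: here `a = s_i`,
`b = s_{i+1}`, `e = p_{i+1/2}`, `f = p_{i+3/2}`, `t = p_{i+1}`, `l = L_i` and `σ = σ_{i+1}`. -/
theorem sig_step_mul_right {a b e f t l σ : A} (aa : a * a = 1) (bb : b * b = 1)
    (ae : a * e = e) (bf : b * f = f) (ef : e * f = f * e)
    (sqs : b * e * b = a * f * a) (ete : e * t * e = e) (ftf : f * t * f = f)
    (lf : l * f = f * l) (ih : σ * e = e) :
    (a * b * σ * b * a + b * e * l * b * e * b + e * l * b * e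
      - b * e * l * a * f * t * e - e * t * f * a * l * e * b) * f = f := by
  have baf : b * a * f = e * b * a := by
    calc b * a * f = b * (a * f * a) * a := by simp only [mul_assoc, aa, mul_one]
      _ = (b * b) * e * b * a := by rw [← sqs]; simp only [mul_assoc]
      _ = e * b * a := by rw [bb, one_mul]
  have h1 : a * b * σ * b * a * f = f := by
    calc a * b * σ * b * a * f = a * b * σ * (b * a * f) := by simp only [mul_assoc]
      _ = a * b * (σ * e) * b * a := by rw [baf]; simp only [mul_assoc]
      _ = a * (b * e * b) * a := by rw [ih]; simp only [mul_assoc]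
      _ = (a * a) * f * (a * a) := by rw [sqs]; simp only [mul_assoc]
      _ = f := by rw [aa, one_mul, mul_one]
  have bef : b * (e * f) = e * f := by rw [ef, ← mul_assoc, bf]
  have faf : f * a * f = e * f := by
    calc f * a * f = (a * a) * f * a * f := by rw [aa, one_mul]
      _ = a * (a * f * a) * f := by simp only [mul_assoc]
      _ = a * (b * (e * (b * f))) := by rw [← sqs]; simp only [mul_assoc]
      _ = e * f := by rw [bf, bef, ← mul_assoc, ae]
  have h2 : b * e * l * b * e * b * f = b * e * l * (e * f) := by
    simp only [mul_assoc, bf, bef]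
  have h3 : e * l * b * e * f = e * l * (e * f) := by
    simp only [mul_assoc, bef]
  have h4 : b * e * l * a * f * t * e * f = b * e * l * (e * f) := by
    calc b * e * l * a * f * t * e * f = b * e * l * a * (f * t * (e * f)) := by
          simp only [mul_assoc]
      _ = b * e * l * a * (f * t * f * e) := by rw [ef]; simp only [mul_assoc]
      _ = b * e * l * ((a * e) * f) := by rw [ftf, ← ef]; simp only [mul_assoc]
      _ = b * e * l * (e * f) := by rw [ae]
  have h5 : e * t * f * a * l * e * b * f = e * l * (e * f) := by
    calc e * t * f * a * l * e * b * f = e * t * f * a * l * (e * f) := by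
          simp only [mul_assoc, bf]
      _ = e * t * f * a * (l * f) * e := by rw [ef]; simp only [mul_assoc]
      _ = e * t * (f * a * f) * l * e := by rw [lf]; simp only [mul_assoc]
      _ = (e * t * e) * f * l * e := by rw [faf]; simp only [mul_assoc]
      _ = e * l * (e * f) := by rw [ete, mul_assoc e f l, ← lf, ef]; simp only [mul_assoc]
  simp only [sub_mul, add_mul, h1, h2, h3, h4, h5]
  abel

/-- Intertwining of the recursion for `σ_{i+2}`: notation as in `sig_step_mul_right`, with
`c = s_{i+2}`, `g = p_{i+5/2}` and `u = p_i`. -/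
theorem sig_step_intertwine {a b c e f g t u l σ : A} (aa : a * a = 1) (bb : b * b = 1)
    (cc : c * c = 1) (ac : a * c = c * a) (bcb : b * c * b = c * b * c)
    (ea : e * a = e) (ef : e * f = f * e) (eg : e * g = g * e) (fg : f * g = g * f)
    (ag : a * g = g * a) (ce : c * e = e * c) (gt : g * t = t * g) (ct : c * t = t * c)
    (fu : f * u = u * f) (aua : a * u * a = t)
    (sqs : b * e * b = a * f * a) (sqs' : c * f * c = b * g * b)
    (lc : l * c = c * l) (lf : l * f = f * l) (lg : l * g = g * l)
    (σc : σ * c = c * σ) (ih : b * σ * f = e * (b * σ)) :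
    c * (a * b * σ * b * a + b * e * l * b * e * b + e * l * b * e
      - b * e * l * a * f * t * e - e * t * f * a * l * e * b) * g =
    f * (c * (a * b * σ * b * a + b * e * l * b * e * b + e * l * b * e
      - b * e * l * a * f * t * e - e * t * f * a * l * e * b)) := by
  have cbg : c * b * g = f * c * b := by
    calc c * b * g = c * (b * g * b) * b := by simp only [mul_assoc, bb, mul_one]
      _ = (c * c) * f * c * b := by rw [← sqs']; simp only [mul_assoc]
      _ = f * c * b := by rw [cc, one_mul]
  have bg : b * g = c * f * c * b := by
    rw [sqs', mul_assoc, bb, mul_one]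
  have gb : g * b = b * c * f * c := by
    calc g * b = (b * b) * g * b := by rw [bb, one_mul]
      _ = b * (b * g * b) := by simp only [mul_assoc]
      _ = b * c * f * c := by rw [← sqs']; simp only [mul_assoc]
  have h1 : c * (a * b * σ * b * a) * g = f * (c * (a * b * σ * b * a)) := by
    calc c * (a * b * σ * b * a) * g = c * a * b * σ * b * (a * g) := by
          simp only [mul_assoc]
      _ = c * a * b * σ * (b * g) * a := by rw [ag]; simp only [mul_assoc]
      _ = (c * a) * b * (σ * c) * f * c * b * a := by rw [bg]; simp only [mul_assoc]
      _ = a * (c * b * c) * σ * f * c * b * a := by rw [σc, ← ac]; simp only [mul_assoc]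
      _ = a * b * c * (b * σ * f) * c * b * a := by rw [← bcb]; simp only [mul_assoc]
      _ = a * b * (c * e) * b * (σ * c) * b * a := by rw [ih]; simp only [mul_assoc]
      _ = a * b * e * (c * b * c) * σ * b * a := by rw [ce, σc]; simp only [mul_assoc]
      _ = a * (b * e * b) * c * b * σ * b * a := by rw [← bcb]; simp only [mul_assoc]
      _ = (a * a) * f * (a * c) * b * σ * b * a := by rw [sqs]; simp only [mul_assoc]
      _ = f * (c * (a * b * σ * b * a)) := by
          rw [aa, ac, one_mul]; simp only [mul_assoc]
  have h2 : c * (b * e * l * b * e * b) * g = f * (c * (b * e * l * b * e * b)) := by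
    calc c * (b * e * l * b * e * b) * g = c * b * e * l * b * e * (b * g) := by
          simp only [mul_assoc]
      _ = c * b * e * l * b * c * (e * f) * c * b := by
          rw [← mul_assoc _ e f, mul_assoc _ c e, ce, bg]; simp only [mul_assoc]
      _ = c * b * e * l * b * c * f * (e * c) * b := by
          rw [ef]; simp only [mul_assoc]
      _ = c * b * e * l * (b * c * f * c) * e * b := by rw [← ce]; simp only [mul_assoc]
      _ = c * b * e * (l * g) * b * e * b := by rw [← gb]; simp only [mul_assoc]
      _ = c * b * (e * g) * l * b * e * b := by rw [lg]; simp only [mul_assoc]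
      _ = (c * b * g) * e * l * b * e * b := by rw [eg]; simp only [mul_assoc]
      _ = f * (c * (b * e * l * b * e * b)) := by rw [cbg]; simp only [mul_assoc]
  have h3 : c * (e * l * b * e) * g = f * (c * (e * l * b * e)) := by
    calc c * (e * l * b * e) * g = (c * e) * l * b * (e * g) := by simp only [mul_assoc]
      _ = e * (c * l) * b * g * e := by rw [ce, eg]; simp only [mul_assoc]
      _ = e * l * (c * b * g) * e := by rw [← lc]; simp only [mul_assoc]
      _ = e * (l * f) * c * b * e := by rw [cbg]; simp only [mul_assoc]
      _ = (e * f) * (l * c) * b * e := by rw [lf]; simp only [mul_assoc]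
      _ = f * (e * c) * l * b * e := by rw [ef, lc]; simp only [mul_assoc]
      _ = f * (c * (e * l * b * e)) := by rw [← ce]; simp only [mul_assoc]
  have h4 : c * (b * e * l * a * f * t * e) * g = f * (c * (b * e * l * a * f * t * e)) := by
    calc c * (b * e * l * a * f * t * e) * g = c * b * e * l * a * f * t * (e * g) := by
          simp only [mul_assoc]
      _ = c * b * e * l * a * (f * g) * t * e := by
          rw [eg, mul_assoc _ f, mul_assoc _ (f * t), mul_assoc f, ← mul_assoc t, ← gt]
          simp only [mul_assoc]
      _ = c * b * e * l * (a * g) * f * t * e := by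
          rw [fg]; simp only [mul_assoc]
      _ = c * b * e * (l * g) * a * f * t * e := by rw [ag]; simp only [mul_assoc]
      _ = c * b * (e * g) * l * a * f * t * e := by rw [lg]; simp only [mul_assoc]
      _ = (c * b * g) * e * l * a * f * t * e := by rw [eg]; simp only [mul_assoc]
      _ = f * (c * (b * e * l * a * f * t * e)) := by rw [cbg]; simp only [mul_assoc]
  have cfc_afa : (c * f * c) * (a * f * a) = (a * f * a) * (c * f * c) := by
    calc (c * f * c) * (a * f * a) = b * g * (b * b) * e * b := by
          rw [sqs', ← sqs]; simp only [mul_assoc]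
      _ = b * (e * g) * b := by rw [bb, mul_one, eg]; simp only [mul_assoc]
      _ = b * e * (b * b) * g * b := by rw [bb, mul_one]; simp only [mul_assoc]
      _ = (a * f * a) * (c * f * c) := by rw [sqs', ← sqs]; simp only [mul_assoc]
  have t_afa : t * (a * f * a) = a * f * a * t := by
    calc t * (a * f * a) = a * u * (a * a) * f * a := by rw [← aua]; simp only [mul_assoc]
      _ = a * (f * u) * a := by rw [aa, mul_one, fu]; simp only [mul_assoc]
      _ = a * f * (a * a) * u * a := by rw [aa, mul_one]; simp only [mul_assoc]
      _ = a * f * a * t := by rw [← aua]; simp only [mul_assoc]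
  have h5 : c * (e * t * f * a * l * e * b) * g = f * (c * (e * t * f * a * l * e * b)) := by
    calc c * (e * t * f * a * l * e * b) * g = (c * e) * t * f * a * l * e * (b * g) := by
          simp only [mul_assoc]
      _ = e * (c * t) * f * a * l * (e * c) * f * c * b := by
          rw [ce, bg]; simp only [mul_assoc]
      _ = e * t * c * f * a * (l * c) * e * f * c * b := by
          rw [ct, ← ce]; simp only [mul_assoc]
      _ = e * t * c * f * (a * c) * l * (e * f) * c * b := by rw [lc]; simp only [mul_assoc]
      _ = e * t * (c * f * c) * a * (l * f) * e * c * b := by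
          rw [ac, ef]; simp only [mul_assoc]
      _ = e * t * (c * f * c) * a * f * (a * a) * l * e * c * b := by
          rw [lf, aa, mul_one]; simp only [mul_assoc]
      _ = e * t * ((c * f * c) * (a * f * a)) * a * l * e * c * b := by
          simp only [mul_assoc]
      _ = e * (t * (a * f * a)) * c * f * c * a * l * e * c * b := by
          rw [cfc_afa]; simp only [mul_assoc]
      _ = (e * a) * f * a * t * c * f * c * a * l * e * c * b := by
          rw [t_afa]; simp only [mul_assoc]
      _ = (e * f) * a * t * c * f * c * a * l * e * c * b := by rw [ea]
      _ = f * (e * a) * t * c * f * c * a * l * e * c * b := by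
          rw [ef]; simp only [mul_assoc]
      _ = f * e * (c * t) * f * (a * c) * l * e * c * b := by
          rw [ea, ct, ac]; simp only [mul_assoc]
      _ = f * (e * c) * t * f * a * l * (c * e) * c * b := by
          rw [mul_assoc _ (a * c) l, mul_assoc a c l, ← lc]; simp only [mul_assoc]
      _ = f * (e * c) * t * f * a * l * e * (c * c) * b := by
          rw [ce]; simp only [mul_assoc]
      _ = f * (c * (e * t * f * a * l * e * b)) := by
          rw [cc, ← ce]; simp only [mul_assoc, one_mul]
  simp only [mul_sub, sub_mul, mul_add, add_mul, h1, h2, h3, h4, h5]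

end Words

variable {k : ℕ} {A : Type*} [Ring A] [Algebra (Polynomial ℤ) A]

theorem sig_two (P : PartitionAlgebra k A) : P.sig 2 = P.s 1 := by
  simp [sig, LS]

theorem sig_add_three (P : PartitionAlgebra k A) (n : ℕ) :
    P.sig (n + 3) =
      P.s (n + 1) * P.s (n + 2) * P.sig (n + 2) * P.s (n + 2) * P.s (n + 1)
        + P.s (n + 2) * P.q (n + 1) * P.L (n + 1) * P.s (n + 2) * P.q (n + 1) * P.s (n + 2)
        + P.q (n + 1) * P.L (n + 1) * P.s (n + 2) * P.q (n + 1)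
        - P.s (n + 2) * P.q (n + 1) * P.L (n + 1) * P.s (n + 1) * P.q (n + 2) * P.p (n + 2)
            * P.q (n + 1)
        - P.q (n + 1) * P.p (n + 2) * P.q (n + 2) * P.s (n + 1) * P.L (n + 1) * P.q (n + 1)
            * P.s (n + 2) := by
  simp only [sig, L]
  conv_lhs => rw [LS]
  simp

theorem L_add_two (P : PartitionAlgebra k A) (n : ℕ) :
    P.L (n + 2) =
      -(P.s (n + 1) * P.L (n + 1) * P.q (n + 1)) - P.q (n + 1) * P.L (n + 1) * P.s (n + 1)
        + P.q (n + 1) * P.L (n + 1) * P.p (n + 2) * P.q (n + 1)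
        + P.s (n + 1) * P.L (n + 1) * P.s (n + 1) + P.sig (n + 2) := by
  simp only [sig, L]
  conv_lhs => rw [LS]
  conv_rhs => rw [LS]

/-- `L_n` and `σ_n` commute with everything that commutes with the generators of `A_n(z)`. -/
theorem commute_L_and_sig (P : PartitionAlgebra k A) (x : A) (n : ℕ)
    (hp : ∀ i, 1 ≤ i → i ≤ n → Commute (P.p i) x)
    (hs : ∀ i, 1 ≤ i → i + 1 ≤ n → Commute (P.s i) x)
    (hq : ∀ i, 1 ≤ i → i + 1 ≤ n → Commute (P.q i) x) :
    Commute (P.L n) x ∧ Commute (P.sig n) x := by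
  induction n using Nat.strong_induction_on with
  | _ n ih =>
    match n with
    | 0 => simp [L, sig, LS]
    | 1 => simpa [L, sig, LS] using hp 1 le_rfl le_rfl
    | n + 2 =>
      have hm : ∀ m, m < n + 2 → Commute (P.L m) x ∧ Commute (P.sig m) x := fun m hlt =>
        ih m hlt (fun i h1 h2 => hp i h1 (by omega)) (fun i h1 h2 => hs i h1 (by omega))
          (fun i h1 h2 => hq i h1 (by omega))
      have s1 := hs (n + 1) (by omega) le_rfl
      have q1 := hq (n + 1) (by omega) le_rfl
      have p2 := hp (n + 2) (by omega) le_rfl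
      have L1 := (hm (n + 1) (by omega)).1
      have σ2 : Commute (P.sig (n + 2)) x := by
        rcases n with _ | n
        · rw [sig_two]; exact s1
        · rw [sig_add_three]
          have s0 := hs (n + 1) (by omega) (by omega)
          have q0 := hq (n + 1) (by omega) (by omega)
          have p1 := hp (n + 2) (by omega) (by omega)
          have L0 := (hm (n + 1) (by omega)).1
          have σ1 := (hm (n + 2) (by omega)).2
          clear hp hs hq
          repeat' first
            | assumption
            | apply Commute.add_left
            | apply Commute.sub_left
            | apply Commute.mul_left
      clear hp hs hq
      refine ⟨?_, σ2⟩
      rw [L_add_two]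
      apply_rules [Commute.add_left, Commute.sub_left, Commute.mul_left, Commute.neg_left]

theorem commute_L_and_sig_s (P : PartitionAlgebra k A) {n j : ℕ} (hnj : n < j)
    (hj : j ≤ k - 1) : Commute (P.L n) (P.s j) ∧ Commute (P.sig n) (P.s j) :=
  P.commute_L_and_sig (P.s j) n
    (fun i h1 h2 => (P.s_p j i (by omega) hj h1 (by omega) (by omega) (by omega)).symm)
    (fun i h1 h2 => P.s_comm i j h1 (by omega) (by omega) hj (by omega) (by omega))
    (fun i h1 h2 => (P.s_q' j i (by omega) hj h1 (by omega) (by omega) (by omega)).symm)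

theorem commute_L_q (P : PartitionAlgebra k A) {n j : ℕ} (hnj : n < j)
    (hj : j ≤ k - 1) : Commute (P.L n) (P.q j) :=
  (P.commute_L_and_sig (P.q j) n
    (fun i h1 h2 => (P.q_p j i (by omega) hj h1 (by omega) (by omega) (by omega)).symm)
    (fun i h1 h2 => P.s_q' i j h1 (by omega) (by omega) hj (by omega) (by omega))
    (fun i h1 h2 => P.q_comm i j h1 (by omega) (by omega) hj)).1

theorem sig_succ_mul_q (P : PartitionAlgebra k A) (n : ℕ) (hn : n + 1 ≤ k - 1) :
    P.sig (n + 2) * P.q (n + 1) = P.q (n + 1) := by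
  induction n with
  | zero => rw [sig_two]; exact P.s_q 1 le_rfl hn
  | succ n ih =>
    rw [sig_add_three]
    exact sig_step_mul_right (P.s_sq (n + 1) (by omega) (by omega))
      (P.s_sq (n + 2) (by omega) hn) (P.s_q (n + 1) (by omega) (by omega))
      (P.s_q (n + 2) (by omega) hn)
      (P.q_comm (n + 1) (n + 2) (by omega) (by omega) (by omega) hn)
      (P.sqs (n + 2) (by omega) hn) (P.qpq₂ (n + 1) (by omega) (by omega))
      (P.qpq₁ (n + 2) (by omega) hn) (P.commute_L_q (by omega) hn) (ih (by omega))

theorem s_mul_sig_mul_q (P : PartitionAlgebra k A) (n : ℕ) (hn : n + 2 ≤ k - 1) :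
    P.s (n + 2) * P.sig (n + 2) * P.q (n + 2) =
      P.q (n + 1) * (P.s (n + 2) * P.sig (n + 2)) := by
  induction n with
  | zero =>
    have h := P.sqs 2 le_rfl hn
    have s1 := P.s_sq 1 le_rfl (by omega)
    have s2 := P.s_sq 2 (by omega) hn
    simp only [sig_two, zero_add] at h ⊢
    calc P.s 2 * P.s 1 * P.q 2 = P.s 2 * (P.s 1 * P.q 2 * P.s 1) * P.s 1 := by
          simp only [mul_assoc, s1, mul_one]
      _ = P.s 2 * P.s 2 * (P.q 1 * (P.s 2 * P.s 1)) := by rw [← h]; simp only [mul_assoc]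
      _ = P.q 1 * (P.s 2 * P.s 1) := by rw [s2, one_mul]
  | succ n ih =>
    rw [sig_add_three]
    exact sig_step_intertwine (u := P.p (n + 1)) (P.s_sq (n + 1) (by omega) (by omega))
      (P.s_sq (n + 2) (by omega) (by omega)) (P.s_sq (n + 3) (by omega) hn)
      (P.s_comm (n + 1) (n + 3) (by omega) (by omega) (by omega) hn (by omega) (by omega))
      (P.braid (n + 2) (by omega) hn)
      (P.q_s (n + 1) (by omega) (by omega))
      (P.q_comm (n + 1) (n + 2) (by omega) (by omega) (by omega) (by omega))
      (P.q_comm (n + 1) (n + 3) (by omega) (by omega) (by omega) hn)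
      (P.q_comm (n + 2) (n + 3) (by omega) (by omega) (by omega) hn)
      (P.s_q' (n + 1) (n + 3) (by omega) (by omega) (by omega) hn (by omega) (by omega))
      (P.s_q' (n + 3) (n + 1) (by omega) hn (by omega) (by omega) (by omega) (by omega))
      (P.q_p (n + 3) (n + 2) (by omega) hn (by omega) (by omega) (by omega) (by omega))
      (P.s_p (n + 3) (n + 2) (by omega) hn (by omega) (by omega) (by omega) (by omega))
      (P.q_p (n + 2) (n + 1) (by omega) (by omega) (by omega) (by omega) (by omega) (by omega))
      (P.sps (n + 1) (by omega) (by omega))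
      (P.sqs (n + 2) (by omega) (by omega)) (P.sqs (n + 3) (by omega) hn)
      (P.commute_L_and_sig_s (by omega) hn).1
      (P.commute_L_q (by omega) (by omega)) (P.commute_L_q (by omega) hn)
      (P.commute_L_and_sig_s (by omega) hn).2 (ih (by omega))

end PartitionAlgebra

/-- Proposition 3.2(1)–(2): `σ_{i+1} p_{i+1/2} = p_{i+1/2}` for `1 ≤ i ≤ k-1`, and
`s_{i+1} σ_{i+1} p_{i+3/2} = p_{i+1/2} s_{i+1} σ_{i+1}` for `1 ≤ i ≤ k-2`. -/
theorem partitionAlgebra_sig_q {k : ℕ} (hk : 2 ≤ k) {A : Type*} [Ring A]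
    [Algebra (Polynomial ℤ) A] (P : PartitionAlgebra k A) :
    (∀ i, 1 ≤ i → i ≤ k - 1 → P.sig (i + 1) * P.q i = P.q i) ∧
    (∀ i, 1 ≤ i → i ≤ k - 2 →
      P.s (i + 1) * P.sig (i + 1) * P.q (i + 1) =
        P.q i * (P.s (i + 1) * P.sig (i + 1))) := by
  refine ⟨fun i h1 h2 => ?_, fun i h1 h2 => ?_⟩
  · obtain ⟨n, rfl⟩ := Nat.exists_eq_add_of_le' h1
    exact P.sig_succ_mul_q n h2
  · obtain ⟨n, rfl⟩ := Nat.exists_eq_add_of_le' h1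
    exact P.s_mul_sig_mul_q n (by omega)
end

section
/- In the partition algebra A_k(z) (k ≥ 2), let * denote the R-algebra anti-automorphism of A_k(z) fixing each generator s_i, p_i, p_{i+1/2} (it exists since the defining relations are invariant under reversal of products). Then for every i with 1 ≤ i ≤ k−1 one has (σ_{i+1/2})* = σ_{i+1/2} and (L_{i+1/2})* = L_{i+1/2}. -/
open Polynomial

namespace PartitionAlgebra

section Recursion

variable {k : ℕ} {A : Type*} [Ring A] [Algebra (Polynomial ℤ) A] (P : PartitionAlgebra k A)

theorem L_succ (n : ℕ) : P.L (n + 2) =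
    -(P.s (n + 1) * P.L (n + 1) * P.q (n + 1)) - P.q (n + 1) * P.L (n + 1) * P.s (n + 1)
      + P.q (n + 1) * P.L (n + 1) * P.p (n + 2) * P.q (n + 1)
      + P.s (n + 1) * P.L (n + 1) * P.s (n + 1) + P.sig (n + 2) := by
  simp only [L, sig, LS]

theorem sig_two_s3 : P.sig 2 = P.s 1 := by
  simp [sig, LS]

theorem sig_succ {n : ℕ} (hn : 1 ≤ n) : P.sig (n + 2) =
    P.s n * P.s (n + 1) * P.sig (n + 1) * P.s (n + 1) * P.s n
      + P.s (n + 1) * P.q n * P.L n * P.s (n + 1) * P.q n * P.s (n + 1)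
      + P.q n * P.L n * P.s (n + 1) * P.q n
      - P.s (n + 1) * P.q n * P.L n * P.s n * P.q (n + 1) * P.p (n + 1) * P.q n
      - P.q n * P.p (n + 1) * P.q (n + 1) * P.s n * P.L n * P.q n * P.s (n + 1) := by
  have h : n ≠ 0 := by omega
  simp only [L, sig, LS, if_neg h]

theorem sigH_succ {n : ℕ} (hn : 1 ≤ n) : P.sigH (n + 1) =
    P.s n * P.s (n + 1) * P.sigH n * P.s (n + 1) * P.s n
      + P.q n * P.L n * P.s (n + 1) * P.q n * P.s (n + 1)
      + P.s (n + 1) * P.q n * P.L n * P.s (n + 1) * P.q n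
      - P.q n * P.L n * P.s n * P.q (n + 1) * P.p (n + 1) * P.q n
      - P.s (n + 1) * P.q n * P.p (n + 1) * P.q (n + 1) * P.s n * P.L n * P.q n
          * P.s (n + 1) := by
  obtain ⟨m, rfl⟩ : ∃ m, n = m + 1 := ⟨n - 1, by omega⟩
  simp only [sigH, LSh]

theorem Lh_succ (n : ℕ) : P.Lh (n + 2) =
    -(P.L (n + 2) * P.q (n + 2)) - P.q (n + 2) * P.L (n + 2)
      + P.q (n + 2) * P.L (n + 2) * P.p (n + 2) * P.q (n + 2)
      + P.s (n + 2) * P.Lh (n + 1) * P.s (n + 2) + P.sigH (n + 2) := by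
  simp only [Lh, sigH, LSh]

/-- `L_n` and `σ_n` commute with every element commuting with the generators of `A_n`. -/
theorem commute_L_sig {x : A} (n : ℕ) (hp : ∀ j, 1 ≤ j → j ≤ n → Commute x (P.p j))
    (hq : ∀ j, 1 ≤ j → j < n → Commute x (P.q j))
    (hs : ∀ j, 1 ≤ j → j < n → Commute x (P.s j)) :
    Commute x (P.L n) ∧ Commute x (P.sig n) := by
  induction n using Nat.strong_induction_on with
  | _ n ih =>
    match n, ih, hp, hq, hs with
    | 0, _, _, _, _ => simp [L, sig, LS]
    | 1, _, hp, _, _ => simpa [L, sig, LS] using hp 1 le_rfl le_rfl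
    | n + 2, ih, hp, hq, hs =>
      have ih' : ∀ m, m < n + 2 → Commute x (P.L m) ∧ Commute x (P.sig m) := fun m hm =>
        ih m hm (fun j h1 h2 => hp j h1 (by omega)) (fun j h1 h2 => hq j h1 (by omega))
          (fun j h1 h2 => hs j h1 (by omega))
      obtain ⟨cL, cσ⟩ := ih' (n + 1) (by omega)
      have cL' := (ih' n (by omega)).1
      have cs := hs (n + 1) (by omega) (by omega)
      have cq := hq (n + 1) (by omega) (by omega)
      have cp := hp (n + 1) (by omega) (by omega)
      have cp' := hp (n + 2) (by omega) (by omega)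
      have hσ : Commute x (P.sig (n + 2)) := by
        rcases Nat.eq_zero_or_pos n with rfl | hn
        · rw [sig_two_s3]
          exact cs
        · have cs' := hs n hn (by omega)
          have cq' := hq n hn (by omega)
          rw [sig_succ P hn]
          exact (((((((cs'.mul_right cs).mul_right cσ).mul_right cs).mul_right cs').add_right
            (((((cs.mul_right cq').mul_right cL').mul_right cs).mul_right cq').mul_right
              cs)).add_right
            (((cq'.mul_right cL').mul_right cs).mul_right cq')).sub_right
            ((((((cs.mul_right cq').mul_right cL').mul_right cs').mul_right cq).mul_right
              cp).mul_right cq')).sub_right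
            ((((((cq'.mul_right cp).mul_right cq).mul_right cs').mul_right cL').mul_right
              cq').mul_right cs)
      refine ⟨?_, hσ⟩
      rw [L_succ]
      exact ((((((cs.mul_right cL).mul_right cq).neg_right).sub_right
        ((cq.mul_right cL).mul_right cs)).add_right
        (((cq.mul_right cL).mul_right cp').mul_right cq)).add_right
        ((cs.mul_right cL).mul_right cs)).add_right hσ

end Recursion

/-- The relations among the elements `p = p_{n+1}`, `p' = p_{n+2}`, `q = p_{n+1/2}`,
`q' = p_{n+3/2}`, `s = s_n`, `s' = s_{n+1}`, `L = L_n` and `σ = σ_{n+1}` of a partition algebra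
from which the corresponding relations for `n + 1` follow. -/
structure LocalRelations {A : Type*} [Ring A] (p p' q q' s s' L σ : A) : Prop where
  s_sq : s * s = 1
  s_sq' : s' * s' = 1
  braid : s * s' * s = s' * s * s'
  s_q : s * q = q
  q_s : q * s = q
  s_q' : s' * q' = q'
  q_s' : q' * s' = q'
  q_q' : q * q' = q' * q
  s_p_conj : s' * p' = p * s'
  p_s_conj : p' * s' = s' * p
  q_p' : q * p' = p' * q
  s_p' : s * p' = p' * s
  conj : s' * q * s' = s * q' * s
  qpq : q * p * q = q
  qpq' : q' * p * q' = q'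
  pqp' : p * q' * p = p
  pqp : p * q * p = p
  L_s' : L * s' = s' * L
  L_q' : L * q' = q' * L
  L_p' : L * p' = p' * L
  σ_p' : σ * p' = p' * σ
  s_σ : s * σ = σ * s
  qpσ : q * p * σ = q * L
  σpq : σ * p * q = L * q
  sσ_q' : s * σ * q' = q' * (s * σ)

namespace LocalRelations

variable {A : Type*} [Ring A] {p p' q q' s s' L σ : A}

theorem commute_conj (h : LocalRelations p p' q q' s s' L σ) :
    s' * q * s' * (s * σ) = s * σ * (s' * q * s') := by
  rw [h.conj]
  linear_combination (norm := noncomm_ring) s * q' * s * h.s_σ - s * h.sσ_q' * s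
    + s * h.s_σ * q' * s

theorem commute_q (h : LocalRelations p p' q q' s s' L σ) :
    q * (s' * (s * σ) * s') = s' * (s * σ) * s' * q := by
  linear_combination (norm := noncomm_ring) s' * h.commute_conj * s'
    - h.s_sq' * q * s' * s * σ * s' + s' * s * σ * s' * q * h.s_sq'

theorem qpqsLq_eq (h : LocalRelations p p' q q' s s' L σ) :
    q * p * q' * s * L * q = q * (s' * (s * σ) * s') := by
  have h1 : p * (s' * (s * σ) * s') = s' * (s * σ) * s' * p := by
    linear_combination (norm := noncomm_ring) - h.s_p_conj * s * σ * s'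
      - s' * h.s_p' * σ * s' - s' * s * h.σ_p' * s' + s' * s * σ * h.p_s_conj
  symm
  calc q * (s' * (s * σ) * s') = q * p * (q * (s' * (s * σ) * s')) := by
        linear_combination (norm := noncomm_ring) - h.qpq * (s' * (s * σ) * s')
    _ = q * (p * (s' * (s * σ) * s')) * q := by rw [h.commute_q]; noncomm_ring
    _ = q * (s' * (s * σ) * s') * (p * q' * p) * q := by
        rw [h1, h.pqp']; noncomm_ring
    _ = q * (p * (s' * (s * σ) * s')) * q' * p * q := by rw [h1]; noncomm_ring
    _ = q * p * s' * (s * σ * q') * p * q := by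
        linear_combination (norm := noncomm_ring) q * p * s' * s * σ * h.s_q' * p * q
    _ = q * p * (s' * q') * s * (σ * p * q) := by rw [h.sσ_q']; noncomm_ring
    _ = q * p * q' * s * L * q := by rw [h.s_q', h.σpq]; noncomm_ring

theorem qLsqpq_eq (h : LocalRelations p p' q q' s s' L σ) :
    q * L * s * q' * p * q = q * (s' * (s * σ) * s') := by
  rw [← h.qpqsLq_eq, ← h.qpσ]
  linear_combination (norm := noncomm_ring) - q * p * h.s_σ * q' * p * q
    + q * p * h.sσ_q' * p * q + q * p * q' * s * h.σpq

/-- The value of `σ_{n+2}`, with its last two terms simplified. -/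
theorem next_sig_eq (h : LocalRelations p p' q q' s s' L σ) :
    s * s' * σ * s' * s + s' * q * L * s' * q * s' + q * L * s' * q
      - s' * q * L * s * q' * p * q - q * p * q' * s * L * q * s' =
    s * s' * σ * s' * s + s' * q * L * s' * q * s' + q * L * s' * q
      - s * σ * s' * q - q * s' * (s * σ) := by
  linear_combination (norm := noncomm_ring) - s' * h.qLsqpq_eq - h.qpqsLq_eq * s'
    - s' * h.commute_q - h.s_sq' * s * σ * s' * q - q * s' * s * σ * h.s_sq'

theorem next_commute (h : LocalRelations p p' q q' s s' L σ) {σ' : A}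
    (hσ' : σ' = s * s' * σ * s' * s + s' * q * L * s' * q * s' + q * L * s' * q
      - s' * q * L * s * q' * p * q - q * p * q' * s * L * q * s') :
    s' * σ' = σ' * s' := by
  rw [hσ', h.next_sig_eq]
  have h1 : s' * (s * s' * σ * s' * s) = s * s' * σ * s' * s * s' := by
    linear_combination (norm := noncomm_ring) - h.braid * σ * s' * s
      + s * s' * h.s_σ * s' * s + s * s' * σ * h.braid
  linear_combination (norm := noncomm_ring) h1 + h.s_sq' * q * L * s' * q * s'
    - s' * q * L * s' * q * h.s_sq' + h.commute_q - h.commute_conj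

theorem next_qpσ (h : LocalRelations p p' q q' s s' L σ) {σ' L' : A}
    (hσ' : σ' = s * s' * σ * s' * s + s' * q * L * s' * q * s' + q * L * s' * q
      - s' * q * L * s * q' * p * q - q * p * q' * s * L * q * s')
    (hL' : L' = -(s * L * q) - q * L * s + q * L * p * q + s * L * s + σ) :
    q' * p' * σ' = q' * L' := by
  have hqps : q' * p' * s' = q' * p := by
    linear_combination (norm := noncomm_ring) q' * h.p_s_conj + h.q_s' * p
  have hqqs : q' * q * s' = q' * q := by
    linear_combination (norm := noncomm_ring) - h.q_q' * s' + q * h.q_s' + h.q_q'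
  have hssq : q' * s * s' = s * s' * q := by
    linear_combination (norm := noncomm_ring) - h.s_sq * q' * s * s'
      - s * h.conj * s' + s * s' * q * h.s_sq'
  have e1 : q' * p' * (s * s' * σ * s' * s) = q' * s * L * s := by
    calc q' * p' * (s * s' * σ * s' * s) = (q' * s * s') * p * σ * s' * s := by
          linear_combination (norm := noncomm_ring) - q' * h.s_p' * s' * σ * s' * s
            + q' * s * h.p_s_conj * σ * s' * s
      _ = s * s' * (q * p * σ) * s' * s := by rw [hssq]; noncomm_ring
      _ = (s * s' * q) * s' * L * s := by
          rw [h.qpσ]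
          linear_combination (norm := noncomm_ring) s * s' * q * h.L_s' * s
      _ = q' * s * L * s := by
          rw [← hssq]
          linear_combination (norm := noncomm_ring) q' * s * h.s_sq' * L * s
  have e2 : q' * p' * (s' * q * L * s' * q * s') = q' * σ := by
    calc q' * p' * (s' * q * L * s' * q * s') = q' * p * (q * L) * (s' * q * s') := by
          linear_combination (norm := noncomm_ring) hqps * q * L * s' * q * s'
      _ = q' * (p * q * p) * σ * (s * q' * s) := by rw [← h.qpσ, h.conj]; noncomm_ring
      _ = q' * p * (s * σ * q') * s := by
          rw [h.pqp]
          linear_combination (norm := noncomm_ring) - q' * p * h.s_σ * q' * s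
      _ = q' * p * q' * (s * σ) * s := by rw [h.sσ_q']; noncomm_ring
      _ = q' * σ := by
          rw [h.qpq', h.s_σ]
          linear_combination (norm := noncomm_ring) q' * σ * h.s_sq
  have e3 : q' * p' * (q * L * s' * q) = q' * q * L * p * q := by
    linear_combination (norm := noncomm_ring) - q' * h.q_p' * L * s' * q
      - q' * q * h.L_p' * s' * q + q' * q * L * h.p_s_conj * q + q' * q * h.L_s' * p * q
      + hqqs * L * p * q
  have e4 : q' * p' * (s * σ * s' * q) = q' * s * L * q := by
    calc q' * p' * (s * σ * s' * q) = (q' * (s * σ)) * s' * p * q := by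
          linear_combination (norm := noncomm_ring) - q' * h.s_p' * σ * s' * q
            - q' * s * h.σ_p' * s' * q + q' * s * σ * h.p_s_conj * q
      _ = (s * σ * q') * p * q := by
          rw [← h.sσ_q']
          linear_combination (norm := noncomm_ring) s * σ * h.q_s' * p * q
      _ = q' * s * (σ * p * q) := by rw [h.sσ_q']; noncomm_ring
      _ = q' * s * L * q := by rw [h.σpq]; noncomm_ring
  have e5 : q' * p' * (q * s' * (s * σ)) = q' * q * L * s := by
    linear_combination (norm := noncomm_ring) - q' * h.q_p' * s' * s * σ
      + q' * q * h.p_s_conj * s * σ + hqqs * p * s * σ + q' * q * p * h.s_σ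
      + q' * h.qpσ * s
  rw [hσ', hL', h.next_sig_eq]
  linear_combination (norm := noncomm_ring) e1 + e2 + e3 - e4 - e5

theorem next_commute_q (h : LocalRelations p p' q q' s s' L σ) {σ' q'' s'' : A}
    (hσ' : σ' = s * s' * σ * s' * s + s' * q * L * s' * q * s' + q * L * s' * q
      - s' * q * L * s * q' * p * q - q * p * q' * s * L * q * s')
    (hconj : s'' * q' * s'' = s' * q'' * s') (hs : Commute s q'') (hq : Commute q q'')
    (hL : Commute L q'') (hσ : Commute σ q'') (hs'' : Commute s s'') (hq'' : Commute q s'')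
    (hσ'' : Commute σ s'') :
    s' * σ' * q'' = q'' * (s' * σ') := by
  have hr : Commute (s * σ) (s' * q'' * s') := by
    rw [← hconj]
    exact ((hs''.mul_left hσ'').mul_right h.sσ_q').mul_right (hs''.mul_left hσ'')
  have hqr : Commute q (s' * q'' * s') := by
    rw [← hconj]
    exact (hq''.mul_right h.q_q').mul_right hq''
  have conj_s' : ∀ x, Commute x (s' * q'' * s') → Commute (s' * x * s') q'' := by
    intro x hx
    have := hx.eq
    change s' * x * s' * q'' = q'' * (s' * x * s')
    linear_combination (norm := noncomm_ring) s' * this * s'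
      - s' * x * s' * q'' * h.s_sq' + h.s_sq' * q'' * s' * x * s'
  have e : s' * σ' = s * (s' * (s * σ) * s') * s + q * L * (s' * q * s')
      + s' * q * s' * L * q - s' * (s * σ) * s' * q - s' * q * s' * (s * σ) := by
    rw [hσ', h.next_sig_eq]
    linear_combination (norm := noncomm_ring) - h.braid * σ * s' * s
      + h.s_sq' * q * L * s' * q * s' + s' * q * h.L_s' * q
  have hu : Commute (s' * (s * σ) * s') q'' := conj_s' _ hr
  have hsqs : Commute (s' * q * s') q'' := conj_s' _ hqr
  rw [e]
  exact (((((hs.mul_left hu).mul_left hs).add_left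
    ((hq.mul_left hL).mul_left hsqs)).add_left ((hsqs.mul_left hL).mul_left hq)).sub_left
    (hu.mul_left hq)).sub_left (hsqs.mul_left (hs.mul_left hσ))

end LocalRelations

variable {k : ℕ} {A : Type*} [Ring A] [Algebra (Polynomial ℤ) A]

/-- `τ` is an additive map reversing products and fixing the generators of `A_k`. -/
structure IsStar (P : PartitionAlgebra k A) (τ : A → A) : Prop where
  map_add : ∀ x y, τ (x + y) = τ x + τ y
  map_mul : ∀ x y, τ (x * y) = τ y * τ x
  map_one : τ 1 = 1
  map_p : ∀ i, 1 ≤ i → i ≤ k → τ (P.p i) = P.p i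
  map_q : ∀ i, 1 ≤ i → i ≤ k - 1 → τ (P.q i) = P.q i
  map_s : ∀ i, 1 ≤ i → i ≤ k - 1 → τ (P.s i) = P.s i

namespace IsStar

variable {P : PartitionAlgebra k A} {τ : A → A}

theorem map_zero (h : IsStar P τ) : τ 0 = 0 := by
  simpa using h.map_add 0 0

theorem map_neg (h : IsStar P τ) (x : A) : τ (-x) = -τ x := by
  have := h.map_add x (-x)
  rw [add_neg_cancel, h.map_zero] at this
  exact (neg_eq_of_add_eq_zero_right this.symm).symm

theorem map_sub (h : IsStar P τ) (x y : A) : τ (x - y) = τ x - τ y := by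
  rw [sub_eq_add_neg, h.map_add, h.map_neg, ← sub_eq_add_neg]

end IsStar

variable (P : PartitionAlgebra k A)

theorem commute_L_s {n m : ℕ} (hnm : n < m) (hm : m + 1 ≤ k) : Commute (P.L n) (P.s m) :=
  (P.commute_L_sig n
    (fun j h1 h2 => P.s_p m j (by omega) (by omega) h1 (by omega) (by omega) (by omega))
    (fun j h1 h2 => P.s_q' m j (by omega) (by omega) h1 (by omega) (by omega) (by omega))
    (fun j h1 h2 => P.s_comm m j (by omega) (by omega) h1 (by omega) (by omega)
      (by omega))).1.symm

theorem commute_sig_s {n m : ℕ} (hnm : n < m) (hm : m + 1 ≤ k) : Commute (P.sig n) (P.s m) :=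
  (P.commute_L_sig n
    (fun j h1 h2 => P.s_p m j (by omega) (by omega) h1 (by omega) (by omega) (by omega))
    (fun j h1 h2 => P.s_q' m j (by omega) (by omega) h1 (by omega) (by omega) (by omega))
    (fun j h1 h2 => P.s_comm m j (by omega) (by omega) h1 (by omega) (by omega)
      (by omega))).2.symm

theorem commute_L_sig_q {n m : ℕ} (hnm : n < m) (hm : m + 1 ≤ k) :
    Commute (P.L n) (P.q m) ∧ Commute (P.sig n) (P.q m) :=
  (P.commute_L_sig n
    (fun j h1 h2 => P.q_p m j (by omega) (by omega) h1 (by omega) (by omega) (by omega))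
    (fun j h1 h2 => P.q_comm m j (by omega) (by omega) h1 (by omega))
    (fun j h1 h2 => (P.s_q' j m h1 (by omega) (by omega) (by omega) (by omega)
      (by omega)).symm)).imp Commute.symm Commute.symm

theorem commute_L_sig_p {n m : ℕ} (hnm : n < m) (hm : m ≤ k) :
    Commute (P.L n) (P.p m) ∧ Commute (P.sig n) (P.p m) :=
  (P.commute_L_sig n
    (fun j h1 h2 => P.p_comm m j (by omega) hm h1 (by omega))
    (fun j h1 h2 => (P.q_p j m h1 (by omega) (by omega) hm (by omega) (by omega)).symm)
    (fun j h1 h2 => (P.s_p j m h1 (by omega) (by omega) hm (by omega)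
      (by omega)).symm)).imp Commute.symm Commute.symm

theorem s_mul_p {n : ℕ} (hn : 1 ≤ n) (hk : n + 1 ≤ k) :
    P.s n * P.p (n + 1) = P.p n * P.s n := by
  linear_combination (norm := noncomm_ring) - P.s n * P.sps n hn (by omega)
    + P.s_sq n hn (by omega) * P.p n * P.s n

theorem p_mul_s {n : ℕ} (hn : 1 ≤ n) (hk : n + 1 ≤ k) :
    P.p (n + 1) * P.s n = P.s n * P.p n := by
  linear_combination (norm := noncomm_ring) - P.sps n hn (by omega) * P.s n
    + P.s n * P.p n * P.s_sq n hn (by omega)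

variable {P} {τ : A → A}

theorem IsStar.map_sig_L (h : IsStar P τ) (n : ℕ) (hn : n ≤ k) :
    τ (P.sig n) = P.sig n ∧ τ (P.L n) = P.L n := by
  induction n using Nat.strong_induction_on with
  | _ n ih =>
    match n, ih, hn with
    | 0, _, _ => exact ⟨by simpa [sig, LS] using h.map_one, by simpa [L, LS] using h.map_zero⟩
    | 1, _, hn =>
      exact ⟨by simpa [sig, LS] using h.map_one, by simpa [L, LS] using h.map_p 1 le_rfl hn⟩
    | n + 2, ih, hn =>
      obtain ⟨iσ, iL⟩ := ih (n + 1) (by omega) (by omega)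
      have iL' := (ih n (by omega) (by omega)).2
      have is := h.map_s (n + 1) (by omega) (by omega)
      have iq := h.map_q (n + 1) (by omega) (by omega)
      have ip := h.map_p (n + 1) (by omega) (by omega)
      have ip' := h.map_p (n + 2) (by omega) (by omega)
      have hσ : τ (P.sig (n + 2)) = P.sig (n + 2) := by
        rcases Nat.eq_zero_or_pos n with rfl | hn0
        · rw [sig_two_s3]
          exact is
        · have is' := h.map_s n hn0 (by omega)
          have iq' := h.map_q n hn0 (by omega)
          have c := (P.commute_L_s (Nat.lt_succ_self n) (by omega)).eq
          rw [sig_succ P hn0]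
          simp only [h.map_add, h.map_sub, h.map_mul, iσ, iL', is, iq, ip, is', iq']
          linear_combination (norm := noncomm_ring) - P.s (n + 1) * P.q n * c * P.q n * P.s (n + 1)
            - P.q n * c * P.q n
      refine ⟨hσ, ?_⟩
      have c := (P.commute_L_sig_p (Nat.lt_succ_self (n + 1)) (by omega)).1.eq
      rw [L_succ]
      simp only [h.map_add, h.map_sub, h.map_neg, h.map_mul, hσ, iL, is, iq, ip']
      linear_combination (norm := noncomm_ring) - P.q (n + 1) * c * P.q (n + 1)

/-- The induction hypothesis: once `σ_{n+1}` satisfies the relations proved at stage `n`, all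
local relations hold. -/
theorem localRelations (h : IsStar P τ) {n : ℕ} (hn : 1 ≤ n) (hk : n + 2 ≤ k)
    (hc : P.s n * P.sig (n + 1) = P.sig (n + 1) * P.s n)
    (hqp : P.q n * P.p (n + 1) * P.sig (n + 1) = P.q n * P.L n)
    (hcq : P.s n * P.sig (n + 1) * P.q (n + 1) = P.q (n + 1) * (P.s n * P.sig (n + 1))) :
    LocalRelations (P.p (n + 1)) (P.p (n + 2)) (P.q n) (P.q (n + 1)) (P.s n) (P.s (n + 1))
      (P.L n) (P.sig (n + 1)) where
  s_sq := P.s_sq n hn (by omega)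
  s_sq' := P.s_sq (n + 1) (by omega) (by omega)
  braid := P.braid n hn (by omega)
  s_q := P.s_q n hn (by omega)
  q_s := P.q_s n hn (by omega)
  s_q' := P.s_q (n + 1) (by omega) (by omega)
  q_s' := P.q_s (n + 1) (by omega) (by omega)
  q_q' := P.q_comm _ _ hn (by omega) (by omega) (by omega)
  s_p_conj := P.s_mul_p (by omega) (by omega)
  p_s_conj := P.p_mul_s (by omega) (by omega)
  q_p' := P.q_p _ _ hn (by omega) (by omega) (by omega) (by omega) (by omega)
  s_p' := P.s_p _ _ hn (by omega) (by omega) (by omega) (by omega) (by omega)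
  conj := P.sqs (n + 1) (by omega) (by omega)
  qpq := P.qpq₂ n hn (by omega)
  qpq' := P.qpq₁ (n + 1) (by omega) (by omega)
  pqp' := P.pqp₂ (n + 1) (by omega) (by omega)
  pqp := P.pqp₁ (n + 1) (by omega) (by omega)
  L_s' := P.commute_L_s (by omega) (by omega)
  L_q' := (P.commute_L_sig_q (by omega) (by omega)).1
  L_p' := (P.commute_L_sig_p (by omega) (by omega)).1
  σ_p' := (P.commute_L_sig_p (by omega) (by omega)).2
  s_σ := hc
  qpσ := hqp
  σpq := by
    have := congrArg τ hqp
    simpa only [h.map_mul, (h.map_sig_L (n + 1) (by omega)).1, (h.map_sig_L n (by omega)).2,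
      h.map_q n hn (by omega), h.map_p (n + 1) (by omega) (by omega), ← mul_assoc] using this
  sσ_q' := hcq

theorem sig_relations (h : IsStar P τ) {n : ℕ} (hn : 1 ≤ n) (hk : n + 1 ≤ k) :
    P.s n * P.sig (n + 1) = P.sig (n + 1) * P.s n ∧
    P.q n * P.p (n + 1) * P.sig (n + 1) = P.q n * P.L n ∧
    (n + 2 ≤ k →
      P.s n * P.sig (n + 1) * P.q (n + 1) = P.q (n + 1) * (P.s n * P.sig (n + 1))) := by
  induction n, hn using Nat.le_induction with
  | base =>
    have hL : P.L 1 = P.p 1 := by simp [L, LS]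
    rw [sig_two_s3, hL]
    refine ⟨rfl, ?_, fun _ => ?_⟩
    · rw [mul_assoc, P.p_mul_s le_rfl hk, ← mul_assoc, P.q_s 1 le_rfl (by omega)]
    · rw [P.s_sq 1 le_rfl (by omega), one_mul, mul_one]
  | succ n hn ih =>
    obtain ⟨hc, hqp, hcq⟩ := ih (by omega)
    have hR := localRelations h hn hk hc hqp (hcq hk)
    have hσ := P.sig_succ hn
    obtain ⟨m, rfl⟩ : ∃ m, n = m + 1 := ⟨n - 1, by omega⟩
    refine ⟨hR.next_commute hσ, hR.next_qpσ hσ (P.L_succ m), fun hk' => ?_⟩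
    have cL := P.commute_L_sig_q (n := m + 1) (m := m + 3) (by omega) (by omega)
    have cσ := P.commute_L_sig_q (n := m + 2) (m := m + 3) (by omega) (by omega)
    refine hR.next_commute_q hσ (P.sqs (m + 3) (by omega) (by omega))
      (P.s_q' _ _ (by omega) (by omega) (by omega) (by omega) (by omega) (by omega))
      (P.q_comm _ _ (by omega) (by omega) (by omega) (by omega)) cL.1 cσ.2
      (P.s_comm _ _ (by omega) (by omega) (by omega) (by omega) (by omega) (by omega))
      (P.s_q' _ _ (by omega) (by omega) (by omega) (by omega) (by omega) (by omega)).symm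
      (P.commute_sig_s (by omega) (by omega))

theorem sigH_eq {n : ℕ} (hn : 1 ≤ n) (hk : n + 1 ≤ k) : P.sigH n = P.s n * P.sig (n + 1) := by
  induction n, hn using Nat.le_induction with
  | base =>
    rw [sig_two_s3, P.s_sq 1 le_rfl (by omega)]
    simp [sigH, LSh]
  | succ n hn ih =>
    rw [sigH_succ P hn, sig_succ P hn, ih (by omega)]
    have hsq := P.s_sq (n + 1) (by omega) (by omega)
    linear_combination (norm := noncomm_ring)
      P.braid n hn (by omega) * P.sig (n + 1) * P.s (n + 1) * P.s n
      - hsq * P.q n * P.L n * P.s (n + 1) * P.q n * P.s (n + 1)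
      + hsq * P.q n * P.L n * P.s n * P.q (n + 1) * P.p (n + 1) * P.q n

theorem IsStar.map_sigH (h : IsStar P τ) {n : ℕ} (hn : 1 ≤ n) (hk : n + 1 ≤ k) :
    τ (P.sigH n) = P.sigH n := by
  rw [sigH_eq hn hk, h.map_mul, (h.map_sig_L (n + 1) hk).1, h.map_s n hn (by omega),
    (sig_relations h hn hk).1]

theorem q_L_p_q (h : IsStar P τ) {n : ℕ} (hn : 1 ≤ n) (hk : n + 1 ≤ k) :
    P.q n * P.L n * P.p n * P.q n = P.q n * P.p (n + 1) * P.sigH n * P.p (n + 1) * P.q n := by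
  obtain ⟨hc, hqp, -⟩ := sig_relations h hn hk
  rw [sigH_eq hn hk, ← hqp, hc]
  have h1 := P.s_mul_p hn hk
  have h2 := P.s_q n hn (by omega)
  linear_combination (norm := noncomm_ring)
    - P.q n * P.p (n + 1) * P.sig (n + 1) * h1 * P.q n
    - P.q n * P.p (n + 1) * P.sig (n + 1) * P.p n * h2

theorem IsStar.map_Lh (h : IsStar P τ) {n : ℕ} (hn : 1 ≤ n) (hk : n + 1 ≤ k) :
    τ (P.Lh n) = P.Lh n := by
  have hqLpq : ∀ m, 1 ≤ m → m + 1 ≤ k →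
      τ (P.q m * P.L m * P.p m * P.q m) = P.q m * P.L m * P.p m * P.q m := by
    intro m hm hmk
    rw [q_L_p_q h hm hmk]
    simp only [h.map_mul, h.map_sigH hm hmk, h.map_q m hm (by omega),
      h.map_p (m + 1) (by omega) hmk, mul_assoc]
  induction n, hn using Nat.le_induction with
  | base =>
    have e : P.Lh 1 = -(P.L 1 * P.q 1) - P.q 1 * P.L 1 + P.q 1 * P.L 1 * P.p 1 * P.q 1 + 1 := by
      simp [Lh, LSh]
    rw [e, h.map_add, h.map_add, hqLpq 1 le_rfl hk]
    simp only [h.map_sub, h.map_neg, h.map_mul, h.map_one, h.map_q 1 le_rfl (by omega),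
      (h.map_sig_L 1 (by omega)).2]
    abel
  | succ n hn ih =>
    obtain ⟨m, rfl⟩ : ∃ m, n = m + 1 := ⟨n - 1, by omega⟩
    rw [Lh_succ, h.map_add, h.map_add, h.map_add, hqLpq (m + 2) (by omega) hk,
      h.map_sigH (by omega) hk]
    simp only [h.map_sub, h.map_neg, h.map_mul, h.map_s (m + 2) (by omega) (by omega),
      h.map_q (m + 2) (by omega) (by omega), (h.map_sig_L (m + 2) (by omega)).2,
      ih (by omega)]
    noncomm_ring

end PartitionAlgebra

/-- Proposition 3.3: the `*` anti-automorphism of `A_k(z)` fixing each generator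
fixes `σ_{i+1/2}` and `L_{i+1/2}` for `1 ≤ i ≤ k-1`. -/
theorem partitionAlgebra_star_fixes_half {k : ℕ} (hk : 2 ≤ k) {A : Type*} [Ring A]
    [Algebra (Polynomial ℤ) A] (P : PartitionAlgebra k A) (τ : A → A)
    (hbij : Function.Bijective τ)
    (hadd : ∀ x y, τ (x + y) = τ x + τ y)
    (hmul : ∀ x y, τ (x * y) = τ y * τ x)
    (hone : τ 1 = 1)
    (hsmul : ∀ (r : Polynomial ℤ) (x : A), τ (r • x) = r • τ x)
    (hp : ∀ i, 1 ≤ i → i ≤ k → τ (P.p i) = P.p i)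
    (hq : ∀ i, 1 ≤ i → i ≤ k - 1 → τ (P.q i) = P.q i)
    (hs : ∀ i, 1 ≤ i → i ≤ k - 1 → τ (P.s i) = P.s i) :
    ∀ i, 1 ≤ i → i ≤ k - 1 → τ (P.sigH i) = P.sigH i ∧ τ (P.Lh i) = P.Lh i := by
  intro i h1 h2
  have h : P.IsStar τ := ⟨hadd, hmul, hone, hp, hq, hs⟩
  exact ⟨h.map_sigH h1 (by omega), h.map_Lh h1 (by omega)⟩
end

section
/- In the partition algebra A_k(z) (k ≥ 3): for every i with 1 ≤ i ≤ k−2 one has s_i s_{i+1} σ_{i+1} s_{i+1} s_i p_{i+1/2} = s_{i+1} p_{i+1/2} L_i s_i p_{i+3/2} p_{i+1} p_{i+1/2} and both of these equal σ_{i+1/2} s_{i+1} p_{i+1/2}. -/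
open Polynomial

section MonoidWords

variable {M : Type*} [Monoid M] {a b q r p P L t : M}

theorem mul_two_of_eq {x y w : M} (h : x * y = w) (z : M) : z * x * y = z * w := by
  rw [mul_assoc, h]

/-- The word-level content of `p_{i-1/2} s_i p_{i-1/2} = p_{i-1/2} p_{i+1/2}`. -/
theorem word_qaq (ha : a * a = 1) (h : a * q * a = b * r * b) (hqb : q * b = q)
    (hqr : r * q = q * r) (hra : r * a = r) : q * a * q = q * r := by
  calc q * a * q = q * (a * q * a) * a := by
        simp only [← mul_assoc, mul_two_of_eq ha, mul_one]
    _ = q * (b * r * b) * a := by rw [h]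
    _ = r * q * b * a := by simp only [← mul_assoc, hqb, hqr]
    _ = r * q * a := by simp only [mul_two_of_eq hqb]
    _ = q * r := by simp only [hqr, mul_two_of_eq hra]

theorem word_qLbrPq (ha : a * a = 1) (h : a * q * a = b * r * b) (hbq : b * q = q)
    (hP : b * p * b = P) (haL : a * L = L * a) (hap : a * p = p * a) (hq : q * p * q = q)
    (hC : t * p = L * q * p) (hD : a * q * a * t = t * (a * q * a)) :
    q * L * b * r * P * q = a * t * a * q := by
  calc q * L * b * r * P * q = q * L * (b * r * b) * p * (b * q) := by
        simp only [← hP, ← mul_assoc]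
    _ = q * (L * a) * q * (a * p) * q := by simp only [← h, hbq, ← mul_assoc]
    _ = q * a * (L * q * p) * a * q := by simp only [← haL, hap, ← mul_assoc]
    _ = q * a * t * (p * a) * q := by simp only [← hC, ← mul_assoc]
    _ = a * a * q * a * t * a * p * q := by simp only [← hap, ha, one_mul, ← mul_assoc]
    _ = a * (a * q * a * t) * a * p * q := by simp only [← mul_assoc]
    _ = a * t * a * q * (a * a) * p * q := by simp only [hD, ← mul_assoc]
    _ = a * t * a * (q * p * q) := by simp only [ha, mul_one, ← mul_assoc]
    _ = a * t * a * q := by rw [hq]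

theorem word_qPrbLq (ha : a * a = 1) (h : a * q * a = b * r * b) (hqb : q * b = q)
    (hP : b * p * b = P) (haL : a * L = L * a) (hap : a * p = p * a) (hq : q * p * q = q)
    (hC : p * t = p * q * L) (hD : a * q * a * t = t * (a * q * a)) :
    q * P * r * b * L * q = q * (a * t * a) := by
  have key := word_qLbrPq (M := Mᵐᵒᵖ) (a := .op a) (b := .op b) (q := .op q) (r := .op r)
    (p := .op p) (P := .op P) (L := .op L) (t := .op t)
  simp only [← MulOpposite.op_mul, ← MulOpposite.op_one, MulOpposite.op_inj, ← mul_assoc] at key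
  exact (key ha h hqb hP haL.symm hap.symm hq hC (by simpa only [← mul_assoc] using hD.symm)).trans
    (by simp only [mul_assoc])

theorem commute_conj {x : M} (hb : b * b = 1) (h : Commute (b * x * b) t) :
    Commute x (b * t * b) := by
  have h' : b * x * b * t = t * b * x * b := by simpa only [← mul_assoc] using h.eq
  have hx : x = b * (b * x * b) * b := by
    simp only [← mul_assoc, hb, one_mul, mul_two_of_eq hb, mul_one]
  calc x * (b * t * b) = b * (b * x * b * t) * b := by
        simp only [← mul_assoc, hb, one_mul]
    _ = b * t * b * x * (b * b) := by rw [h']; simp only [← mul_assoc]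
    _ = b * t * b * x := by rw [hb, mul_one]

end MonoidWords

section RingWords

variable {A : Type*} [Ring A] {a b c d q r p P L t : A}

/-- The recursion for `σ_{i+1/2}`, with the last two terms rewritten. -/
def tauStep (a b q L t : A) : A :=
  b * (a * t * a) * b + q * L * (a * q * a) + a * q * a * L * q - a * t * a * q - a * q * a * t

/-- The recursion for `L_{i+1}`, with `σ_{i+1}` written as `s_i σ_{i+1/2}`. -/
def LStep (b q P L t : A) : A :=
  -(b * L * q) - q * L * b + q * L * P * q + b * L * b + b * t

theorem tauStep_mul (ha : a * a = 1) (hb : b * b = 1) (h : a * q * a = b * r * b)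
    (hqb : q * b = q) (hqr : r * q = q * r) (hra : r * a = r) (har : a * r = r)
    (hP : b * p * b = P) (haL : a * L = L * a) (hrL : r * L = L * r) (hap : a * p = p * a)
    (hgP : a * q * a * P = P * (a * q * a)) (hPqP : P * q * P = P)
    (hD : a * q * a * t = t * (a * q * a)) (htb : t * b = b * t) (htr : t * r = r * t)
    (hC : t * p = L * q * p) :
    tauStep a b q L t * P = LStep b q P L t * r * P := by
  have hbP : b * P = p * b := by rw [← hP]; simp only [← mul_assoc, hb, one_mul]
  have hbr : b * r = a * q * a * b := by rw [h, mul_assoc, hb, mul_one]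
  have hbrP : b * r * P = a * q * a * p * b := by rw [hbr, mul_assoc, hbP, ← mul_assoc]
  have huq : q * (a * t * a) = a * t * a * q := by
    calc q * (a * t * a) = a * (a * q * a * t) * a := by
          simp only [← mul_assoc, ha, one_mul]
      _ = a * t * a * q * (a * a) := by rw [hD]; simp only [← mul_assoc]
      _ = a * t * a * q := by rw [ha, mul_one]
  have hup : a * t * a * p = L * (a * q * a) * p := by
    calc a * t * a * p = a * (t * p) * a := by
          rw [mul_assoc _ a p, hap]; simp only [← mul_assoc]
      _ = a * L * q * (p * a) := by rw [hC]; simp only [← mul_assoc]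
      _ = L * (a * q * a) * p := by rw [haL, ← hap]; simp only [← mul_assoc]
  have e1 : b * L * b * r * P = b * (a * t * a) * b * P := by
    calc b * L * b * r * P = b * L * (b * r * P) := by simp only [← mul_assoc]
      _ = b * (L * (a * q * a) * p) * b := by rw [hbrP]; simp only [← mul_assoc]
      _ = b * (a * t * a) * (p * b) := by rw [← hup]; simp only [← mul_assoc]
      _ = b * (a * t * a) * b * P := by rw [← hbP]; simp only [← mul_assoc]
  have hgq : a * q * a * q = r * q := by
    rw [mul_assoc (a * q), mul_assoc a, ← mul_assoc q, word_qaq ha h hqb hqr hra, ← hqr,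
      ← mul_assoc, har]
  have e2 : q * L * P * q * r * P = q * L * (a * q * a) * P := by
    calc q * L * P * q * r * P = q * L * P * (r * q) * P := by rw [hqr]; simp only [← mul_assoc]
      _ = q * L * (P * (a * q * a)) * q * P := by rw [← hgq]; simp only [← mul_assoc]
      _ = q * L * (a * q * a) * (P * q * P) := by rw [← hgP]; simp only [← mul_assoc]
      _ = q * L * (a * q * a) * P := by rw [hPqP]
  have htP : t * P = b * L * q * P := by
    calc t * P = t * b * p * b := by rw [← hP]; simp only [← mul_assoc]
      _ = b * (t * p) * b := by rw [htb]; simp only [← mul_assoc]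
      _ = b * L * q * (p * b) := by rw [hC]; simp only [← mul_assoc]
      _ = b * L * (q * b) * P := by rw [← hbP]; simp only [← mul_assoc]
      _ = b * L * q * P := by rw [hqb]
  have e3 : b * t * r * P = a * q * a * L * q * P := by
    calc b * t * r * P = b * r * (t * P) := by
          rw [mul_assoc b, htr]; simp only [← mul_assoc]
      _ = b * r * b * L * q * P := by rw [htP]; simp only [← mul_assoc]
      _ = a * q * a * L * q * P := by rw [h]
  have e4 : q * L * b * r * P = a * t * a * q * P := by
    calc q * L * b * r * P = q * L * (b * r * P) := by simp only [← mul_assoc]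
      _ = q * (L * (a * q * a) * p) * b := by rw [hbrP]; simp only [← mul_assoc]
      _ = q * (a * t * a) * (p * b) := by rw [← hup]; simp only [← mul_assoc]
      _ = a * t * a * (q * b) * P := by rw [← hbP, huq]; simp only [← mul_assoc]
      _ = a * t * a * q * P := by rw [hqb]
  have e5 : b * L * q * r * P = a * q * a * t * P := by
    calc b * L * q * r * P = b * (L * (q * r)) * P := by simp only [← mul_assoc]
      _ = b * (L * r) * q * P := by rw [← hqr]; simp only [← mul_assoc]
      _ = b * r * L * q * P := by rw [← hrL]; simp only [← mul_assoc]
      _ = b * r * (b * b) * L * q * P := by rw [hb, mul_one]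
      _ = b * r * b * (b * L * q * P) := by simp only [← mul_assoc]
      _ = a * q * a * t * P := by rw [← htP, ← h]; simp only [← mul_assoc]
  simp only [tauStep, LStep, add_mul, sub_mul, neg_mul, e1, e2, e3, e4, e5]
  abel

theorem mul_tauStep (ha : a * a = 1) (hb : b * b = 1) (h : a * q * a = b * r * b)
    (hbq : b * q = q) (hqr : r * q = q * r) (hra : r * a = r) (har : a * r = r)
    (hP : b * p * b = P) (haL : a * L = L * a) (hLP : L * P = P * L) (hrL : r * L = L * r)
    (hap : a * p = p * a) (hgP : a * q * a * P = P * (a * q * a)) (hPqP : P * q * P = P)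
    (hD : a * q * a * t = t * (a * q * a)) (htb : t * b = b * t) (htr : t * r = r * t)
    (hC : p * t = p * q * L) :
    P * tauStep a b q L t = P * r * LStep b q P L t := by
  have huq : q * (a * t * a) = a * t * a * q := by
    calc q * (a * t * a) = a * (a * q * a * t) * a := by
          simp only [← mul_assoc, ha, one_mul]
      _ = a * t * a * q * (a * a) := by rw [hD]; simp only [← mul_assoc]
      _ = a * t * a * q := by rw [ha, mul_one]
  have key := tauStep_mul (A := Aᵐᵒᵖ) (a := .op a) (b := .op b) (q := .op q) (r := .op r)
    (p := .op p) (P := .op P) (L := .op L) (t := .op t)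
  have h1 : tauStep (.op a) (.op b) (.op q) (.op L) (.op t)
      = MulOpposite.op (tauStep a b q L t) := by
    simp only [tauStep, ← huq, hD, ← MulOpposite.op_mul, ← MulOpposite.op_add, ← MulOpposite.op_sub,
      MulOpposite.op_inj, ← mul_assoc]
    abel
  have h2 : LStep (.op b) (.op q) (.op P) (.op L) (.op t)
      = MulOpposite.op (LStep b q P L t) := by
    simp only [LStep, ← htb, ← MulOpposite.op_mul, ← MulOpposite.op_add, ← MulOpposite.op_sub,
      ← MulOpposite.op_neg, MulOpposite.op_inj, ← mul_assoc]
    rw [mul_assoc q P, ← hLP, ← mul_assoc]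
    abel
  rw [h1, h2] at key
  simp only [← MulOpposite.op_mul, ← MulOpposite.op_one, MulOpposite.op_inj] at key
  simp only [← mul_assoc] at key h hP hPqP hgP hD ⊢
  exact key ha hb h hbq hqr.symm har hra hP haL.symm hrL.symm hap.symm hgP.symm hPqP
    hD.symm htb.symm htr.symm hC

theorem commute_tauStep (ha : a * a = 1) (hab : a * b * a = b * a * b) (haL : a * L = L * a)
    (hD : a * q * a * t = t * (a * q * a)) (htb : t * b = b * t) :
    Commute a (tauStep a b q L t) := by
  have e1 : a * (b * (a * t * a) * b) = b * (a * t * a) * b * a := by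
    calc a * (b * (a * t * a) * b) = a * b * a * t * a * b := by simp only [← mul_assoc]
      _ = b * a * (b * t) * a * b := by rw [hab]; simp only [← mul_assoc]
      _ = b * a * t * (b * a * b) := by rw [← htb]; simp only [← mul_assoc]
      _ = b * (a * t * a) * b * a := by rw [← hab]; simp only [← mul_assoc]
  have e2 : a * (q * L * (a * q * a)) = a * q * a * L * q * a := by
    calc a * (q * L * (a * q * a)) = a * q * (L * a) * q * a := by simp only [← mul_assoc]
      _ = a * q * a * L * q * a := by rw [← haL]; simp only [← mul_assoc]
  have e3 : a * (a * q * a * L * q) = q * L * (a * q * a) * a := by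
    calc a * (a * q * a * L * q) = a * a * q * (a * L) * q := by simp only [← mul_assoc]
      _ = q * L * a * q * (a * a) := by rw [haL, ha, mul_one]; simp only [← mul_assoc, one_mul]
      _ = q * L * (a * q * a) * a := by simp only [← mul_assoc]
  have e4 : a * (a * t * a * q) = a * q * a * t * a := by
    calc a * (a * t * a * q) = t * (a * q * a) * a := by
          simp only [← mul_assoc, ha, one_mul, mul_two_of_eq ha, mul_one]
      _ = a * q * a * t * a := by rw [← hD]
  have e5 : a * (a * q * a * t) = a * t * a * q * a := by
    rw [hD]; simp only [← mul_assoc]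
  unfold Commute SemiconjBy tauStep
  simp only [mul_add, mul_sub, add_mul, sub_mul, e1, e2, e3, e4, e5]
  abel

theorem commute_tauStep_of_far {x : A} (hb : Commute x b) (hu : Commute x (a * t * a))
    (hq : Commute x q) (hL : Commute x L) (hg : Commute x (a * q * a)) (ht : Commute x t) :
    Commute x (tauStep a b q L t) :=
  (((((hb.mul_right hu).mul_right hb).add_right ((hq.mul_right hL).mul_right hg)).add_right
    ((hg.mul_right hL).mul_right hq)).sub_right (hu.mul_right hq)).sub_right (hg.mul_right ht)

theorem commute_LStep_of_far {x : A} (hb : Commute x b) (hq : Commute x q) (hP : Commute x P)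
    (hL : Commute x L) (ht : Commute x t) : Commute x (LStep b q P L t) :=
  ((((((hb.mul_right hL).mul_right hq).neg_right).sub_right
    ((hq.mul_right hL).mul_right hb)).add_right (((hq.mul_right hL).mul_right hP).mul_right hq)).add_right
    ((hb.mul_right hL).mul_right hb)).add_right (hb.mul_right ht)

/-- `c * r * c` plays the role of the element joining strands `i` and `i + 2`. -/
theorem commute_conj_tauStep (ha : a * a = 1) (hb : b * b = 1) (hc : c * c = 1)
    (h : a * q * a = b * r * b) (h' : c * r * c = a * d * a) (hqb : q * b = q)
    (hqr : r * q = q * r) (hra : r * a = r) (har : a * r = r)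
    (hac : a * c * a = c * a * c) (hbc : Commute b c) (hqc : Commute q c) (htc : Commute t c)
    (hLc : Commute L c) (hLr : Commute L r) (hqd : Commute q d) (htr : Commute t r)
    (hD : Commute (a * q * a) t) :
    Commute (c * r * c) (tauStep a b q L t) := by
  have hqrc : Commute q r := hqr.symm
  have hcrc {x : A} (h₁ : Commute x c) (h₂ : Commute x r) : Commute (c * r * c) x :=
    ((h₁.mul_right h₂).mul_right h₁).symm
  have hg : Commute (c * r * c) (a * q * a) := by
    rw [h']
    unfold Commute SemiconjBy
    calc a * d * a * (a * q * a) = a * (d * q) * a := by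
          simp only [← mul_assoc, mul_two_of_eq ha, mul_one]
      _ = a * q * a * (a * d * a) := by
          rw [← hqd.eq]; simp only [← mul_assoc, mul_two_of_eq ha, mul_one]
  have hgq : a * q * a * q = r * q := by
    rw [mul_assoc (a * q), mul_assoc a, ← mul_assoc q, word_qaq ha h hqb hqr hra, ← hqr,
      ← mul_assoc, har]
  have hq2 : c * (a * q * a) * c * q = c * r * c * q := by
    calc c * (a * q * a) * c * q = c * (a * q * a * q) * c := by
          rw [mul_assoc _ c q, ← hqc.eq]; simp only [← mul_assoc]
      _ = c * r * (q * c) := by rw [hgq]; simp only [← mul_assoc]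
      _ = c * r * c * q := by rw [hqc.eq]; simp only [← mul_assoc]
  have hconj : a * (c * (a * q * a) * c) * a = c * (a * q * a) * c := by
    calc a * (c * (a * q * a) * c) * a = a * c * a * q * (a * c * a) := by
          simp only [← mul_assoc]
      _ = c * a * (c * q) * c * a * c := by rw [hac]; simp only [← mul_assoc]
      _ = c * (a * q * a) * c := by
          rw [← hqc.eq]; simp only [← mul_assoc, mul_two_of_eq hc, mul_one]
  have hu2 : Commute (c * (a * q * a) * c) (a * t * a) := by
    apply commute_conj ha
    rw [hconj]
    exact (htc.symm.mul_left hD).mul_left htc.symm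
  have huq : Commute q (a * t * a) := commute_conj ha hD
  have hub : Commute (c * r * c) (b * (a * t * a) * b) := by
    apply commute_conj hb
    have : b * (c * r * c) * b = c * (a * q * a) * c := by
      rw [h]
      calc b * (c * r * c) * b = b * c * r * (c * b) := by simp only [← mul_assoc]
        _ = c * b * r * (b * c) := by rw [← hbc.eq]
        _ = c * (b * r * b) * c := by simp only [← mul_assoc]
    rw [this]
    exact hu2
  have huq' : Commute (c * r * c) (a * t * a * q) := by
    unfold Commute SemiconjBy
    have hq1 := (hcrc hqc hqrc).eq
    calc c * r * c * (a * t * a * q) = c * r * c * q * (a * t * a) := by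
          rw [← huq.eq]; simp only [← mul_assoc]
      _ = c * (a * q * a) * c * (q * (a * t * a)) := by
          rw [← hq2, mul_assoc]
      _ = c * (a * q * a) * c * (a * t * a) * q := by rw [huq.eq, ← mul_assoc]
      _ = a * t * a * (c * (a * q * a) * c * q) := by rw [hu2.eq, mul_assoc]
      _ = a * t * a * q * (c * r * c) := by rw [hq2, hq1, ← mul_assoc]
  have hq := hcrc hqc hqrc
  have hL := hcrc hLc hLr
  exact (((hub.add_right ((hq.mul_right hL).mul_right hg)).add_right
    ((hg.mul_right hL).mul_right hq)).sub_right huq').sub_right (hg.mul_right (hcrc htc htr))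

end RingWords

namespace PartitionAlgebra

variable {k : ℕ} {A : Type*} [Ring A] [Algebra (Polynomial ℤ) A]

theorem sigH_add_two (P : PartitionAlgebra k A) (m : ℕ) :
    P.sigH (m + 1 + 1) =
      P.s (m + 1) * P.s (m + 1 + 1) * P.sigH (m + 1) * P.s (m + 1 + 1) * P.s (m + 1)
        + P.q (m + 1) * P.L (m + 1) * P.s (m + 1 + 1) * P.q (m + 1) * P.s (m + 1 + 1)
        + P.s (m + 1 + 1) * P.q (m + 1) * P.L (m + 1) * P.s (m + 1 + 1) * P.q (m + 1)
        - P.q (m + 1) * P.L (m + 1) * P.s (m + 1) * P.q (m + 1 + 1) * P.p (m + 1 + 1) * P.q (m + 1)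
        - P.s (m + 1 + 1) * P.q (m + 1) * P.p (m + 1 + 1) * P.q (m + 1 + 1) * P.s (m + 1)
          * P.L (m + 1) * P.q (m + 1) * P.s (m + 1 + 1) :=
  rfl

theorem sig_succ_s5 (P : PartitionAlgebra k A) (n : ℕ) (h₁ : 1 ≤ n) (hn : n ≤ k - 1) :
    P.sig (n + 1) = P.s n * P.sigH n := by
  induction n, h₁ using Nat.le_induction with
  | base => simp [sig, sigH, LS, LSh]
  | succ n h₁ ih =>
    obtain ⟨m, rfl⟩ := Nat.exists_eq_add_of_le' h₁
    specialize ih (by omega)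
    have hs := P.s_sq (m + 1 + 1) (by omega) hn
    have hb := P.braid (m + 1) (by omega) (by omega)
    have e : P.sig (m + 1 + 1 + 1) =
        P.s (m + 1) * P.s (m + 1 + 1) * P.sig (m + 1 + 1) * P.s (m + 1 + 1) * P.s (m + 1)
          + P.s (m + 1 + 1) * P.q (m + 1) * P.L (m + 1) * P.s (m + 1 + 1) * P.q (m + 1)
            * P.s (m + 1 + 1)
          + P.q (m + 1) * P.L (m + 1) * P.s (m + 1 + 1) * P.q (m + 1)
          - P.s (m + 1 + 1) * P.q (m + 1) * P.L (m + 1) * P.s (m + 1) * P.q (m + 1 + 1)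
            * P.p (m + 1 + 1) * P.q (m + 1)
          - P.q (m + 1) * P.p (m + 1 + 1) * P.q (m + 1 + 1) * P.s (m + 1) * P.L (m + 1)
            * P.q (m + 1) * P.s (m + 1 + 1) := rfl
    rw [e, sigH_add_two, ih]
    simp only [mul_add, mul_sub, ← mul_assoc, hs, one_mul, hb]

/-- The properties of `L_n` and `σ_{n+1/2}` that are propagated by their recursions: commutation
with generators further along, and the products with `p_n`. -/
structure GoodAt (P : PartitionAlgebra k A) (n : ℕ) : Prop where
  sigH_s : ∀ j, n + 2 ≤ j → j ≤ k - 1 → Commute (P.sigH n) (P.s j)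
  sigH_p : ∀ j, n + 2 ≤ j → j ≤ k → Commute (P.sigH n) (P.p j)
  sigH_q : ∀ j, n + 1 ≤ j → j ≤ k - 1 → Commute (P.sigH n) (P.q j)
  L_s : ∀ j, n + 1 ≤ j → j ≤ k - 1 → Commute (P.L n) (P.s j)
  L_p : ∀ j, n + 1 ≤ j → j ≤ k → Commute (P.L n) (P.p j)
  L_q : ∀ j, n + 1 ≤ j → j ≤ k - 1 → Commute (P.L n) (P.q j)
  sigH_s_self : Commute (P.sigH n) (P.s n)
  sigH_conj : n + 1 ≤ k - 1 → Commute (P.s (n + 1) * P.q n * P.s (n + 1)) (P.sigH n)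
  sigH_mul_p : P.sigH n * P.p n = P.L n * P.q n * P.p n
  p_mul_sigH : P.p n * P.sigH n = P.p n * P.q n * P.L n

theorem goodAt_one (P : PartitionAlgebra k A) (hk : 1 ≤ k - 1) : P.GoodAt 1 := by
  have hσ : P.sigH 1 = 1 := rfl
  have hL : P.L 1 = P.p 1 := rfl
  refine ⟨?_, ?_, ?_, ?_, ?_, ?_, ?_, ?_, ?_, ?_⟩
  all_goals simp only [hσ, hL, Commute.one_left, Commute.one_right, implies_true, one_mul, mul_one]
  · exact fun j h₁ h₂ => (P.s_p j 1 (by omega) h₂ le_rfl (by omega) (by omega) (by omega)).symm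
  · exact fun j h₁ h₂ => P.p_comm 1 j le_rfl (by omega) (by omega) h₂
  · exact fun j h₁ h₂ => (P.q_p j 1 (by omega) h₂ le_rfl (by omega) (by omega) (by omega)).symm
  · exact (P.pqp₂ 1 le_rfl hk).symm
  · exact (P.pqp₂ 1 le_rfl hk).symm

/-- `s_{n+1} p_{n+1/2} s_{n+1} = s_n p_{n+3/2} s_n`, without truncated subtraction. -/
theorem conj_q (P : PartitionAlgebra k A) (n : ℕ) (h₁ : 1 ≤ n) (hn : n + 1 ≤ k - 1) :
    P.s (n + 1) * P.q n * P.s (n + 1) = P.s n * P.q (n + 1) * P.s n := by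
  simpa using P.sqs (n + 1) (by omega) hn

theorem conj_q_mul_p (P : PartitionAlgebra k A) (n : ℕ) (h₁ : 1 ≤ n) (hn : n + 1 ≤ k - 1) :
    P.s (n + 1) * P.q n * P.s (n + 1) * P.p (n + 1) =
      P.p (n + 1) * (P.s (n + 1) * P.q n * P.s (n + 1)) := by
  have ha := P.s_sq (n + 1) (by omega) hn
  have hP := P.sps (n + 1) (by omega) hn
  have hqP := P.q_p n (n + 1 + 1) h₁ (by omega) (by omega) (by omega) (by omega) (by omega)
  have haP : P.s (n + 1) * P.p (n + 1) = P.p (n + 1 + 1) * P.s (n + 1) := by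
    rw [← hP, mul_assoc, ha, mul_one]
  have hPa : P.s (n + 1) * P.p (n + 1 + 1) = P.p (n + 1) * P.s (n + 1) := by
    rw [← hP]; simp only [← mul_assoc, ha, one_mul]
  calc _ = P.s (n + 1) * P.q n * (P.s (n + 1) * P.p (n + 1)) := by simp only [← mul_assoc]
    _ = P.s (n + 1) * (P.q n * P.p (n + 1 + 1)) * P.s (n + 1) := by
      rw [haP]; simp only [← mul_assoc]
    _ = P.s (n + 1) * P.p (n + 1 + 1) * P.q n * P.s (n + 1) := by
      rw [hqP]; simp only [← mul_assoc]
    _ = _ := by rw [hPa]; simp only [← mul_assoc]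

namespace GoodAt

variable {P : PartitionAlgebra k A} {n : ℕ}

theorem q_L_s_q_p_q (h : P.GoodAt n) (h₁ : 1 ≤ n) (hn : n + 1 ≤ k - 1) :
    P.q n * P.L n * P.s n * P.q (n + 1) * P.p (n + 1) * P.q n =
      P.s (n + 1) * P.sigH n * P.s (n + 1) * P.q n :=
  word_qLbrPq (P.s_sq (n + 1) (by omega) hn) (P.conj_q n h₁ hn) (P.s_q n h₁ (by omega))
    (P.sps n h₁ (by omega)) (h.L_s (n + 1) le_rfl hn).eq.symm
    (P.s_p (n + 1) n (by omega) hn h₁ (by omega) (by omega) (by omega)) (P.qpq₁ n h₁ (by omega))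
    h.sigH_mul_p (h.sigH_conj hn).eq

theorem q_p_q_s_L_q (h : P.GoodAt n) (h₁ : 1 ≤ n) (hn : n + 1 ≤ k - 1) :
    P.q n * P.p (n + 1) * P.q (n + 1) * P.s n * P.L n * P.q n =
      P.q n * (P.s (n + 1) * P.sigH n * P.s (n + 1)) :=
  word_qPrbLq (P.s_sq (n + 1) (by omega) hn) (P.conj_q n h₁ hn) (P.q_s n h₁ (by omega))
    (P.sps n h₁ (by omega)) (h.L_s (n + 1) le_rfl hn).eq.symm
    (P.s_p (n + 1) n (by omega) hn h₁ (by omega) (by omega) (by omega)) (P.qpq₁ n h₁ (by omega))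
    h.p_mul_sigH (h.sigH_conj hn).eq

theorem sigH_succ (h : P.GoodAt n) (h₁ : 1 ≤ n) (hn : n + 1 ≤ k - 1) :
    P.sigH (n + 1) = tauStep (P.s (n + 1)) (P.s n) (P.q n) (P.L n) (P.sigH n) := by
  obtain ⟨m, rfl⟩ := Nat.exists_eq_add_of_le' h₁
  have ha := P.s_sq (m + 1 + 1) (by omega) hn
  have e' : P.s (m + 1 + 1) * P.q (m + 1) * P.p (m + 1 + 1) * P.q (m + 1 + 1) * P.s (m + 1)
      * P.L (m + 1) * P.q (m + 1) * P.s (m + 1 + 1) =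
      P.s (m + 1 + 1) * P.q (m + 1) * P.s (m + 1 + 1) * P.sigH (m + 1) := by
    have := h.q_p_q_s_L_q h₁ hn
    calc _ = P.s (m + 1 + 1) * (P.q (m + 1) * P.p (m + 1 + 1) * P.q (m + 1 + 1) * P.s (m + 1)
          * P.L (m + 1) * P.q (m + 1)) * P.s (m + 1 + 1) := by simp only [← mul_assoc]
      _ = _ := by rw [this]; simp only [← mul_assoc, mul_two_of_eq ha, mul_one]
  have hL := (h.L_s (m + 1 + 1) le_rfl hn).eq
  rw [sigH_add_two, e', h.q_L_s_q_p_q h₁ hn]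
  simp only [tauStep, ← mul_assoc, mul_two_of_eq hL]

theorem L_succ (h₁ : 1 ≤ n) (hn : n ≤ k - 1) :
    P.L (n + 1) = LStep (P.s n) (P.q n) (P.p (n + 1)) (P.L n) (P.sigH n) := by
  have hσ := P.sig_succ_s5 n h₁ hn
  obtain ⟨m, rfl⟩ := Nat.exists_eq_add_of_le' h₁
  rw [LStep, ← hσ]
  rfl

theorem succ (h : P.GoodAt n) (h₁ : 1 ≤ n) (hn : n + 1 ≤ k - 1) : P.GoodAt (n + 1) := by
  have ha := P.s_sq (n + 1) (by omega) hn
  have hb := P.s_sq n h₁ (by omega)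
  have hg := P.conj_q n h₁ hn
  have hL := h.L_s (n + 1) le_rfl hn
  have hLP := h.L_p (n + 1) le_rfl (by omega)
  have hLr := h.L_q (n + 1) le_rfl hn
  have htr := h.sigH_q (n + 1) le_rfl hn
  have hD := h.sigH_conj hn
  have hqr := P.q_comm n (n + 1) h₁ (by omega) (by omega) hn
  have hap := P.s_p (n + 1) n (by omega) hn h₁ (by omega) (by omega) (by omega)
  have hra := P.q_s (n + 1) (by omega) hn
  have har := P.s_q (n + 1) (by omega) hn
  have hqb := P.q_s n h₁ (by omega)
  have hPqP : P.p (n + 1) * P.q n * P.p (n + 1) = P.p (n + 1) := by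
    simpa using P.pqp₁ (n + 1) (by omega) (by omega)
  have hbs (j : ℕ) (h₂ : n + 2 ≤ j) (h₃ : j ≤ k - 1) : Commute (P.s j) (P.s n) :=
    P.s_comm j n (by omega) h₃ h₁ (by omega) (by omega) (by omega)
  have hbp (j : ℕ) (h₂ : n + 2 ≤ j) (h₃ : j ≤ k) : Commute (P.p j) (P.s n) :=
    (P.s_p n j h₁ (by omega) (by omega) h₃ (by omega) (by omega)).symm
  have hbq (j : ℕ) (h₂ : n + 2 ≤ j) (h₃ : j ≤ k - 1) : Commute (P.q j) (P.s n) :=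
    (P.s_q' n j h₁ (by omega) (by omega) h₃ (by omega) (by omega)).symm
  have hqs (j : ℕ) (h₂ : n + 2 ≤ j) (h₃ : j ≤ k - 1) : Commute (P.s j) (P.q n) :=
    P.s_q' j n (by omega) h₃ h₁ (by omega) (by omega) (by omega)
  have hqp (j : ℕ) (h₂ : n + 2 ≤ j) (h₃ : j ≤ k) : Commute (P.p j) (P.q n) :=
    (P.q_p n j h₁ (by omega) (by omega) h₃ (by omega) (by omega)).symm
  have hqq (j : ℕ) (h₂ : n + 2 ≤ j) (h₃ : j ≤ k - 1) : Commute (P.q j) (P.q n) :=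
    P.q_comm j n (by omega) h₃ h₁ (by omega)
  have hPs (j : ℕ) (h₂ : n + 2 ≤ j) (h₃ : j ≤ k - 1) : Commute (P.s j) (P.p (n + 1)) :=
    P.s_p j (n + 1) (by omega) h₃ (by omega) (by omega) (by omega) (by omega)
  have hPp (j : ℕ) (h₂ : n + 2 ≤ j) (h₃ : j ≤ k) : Commute (P.p j) (P.p (n + 1)) :=
    P.p_comm j (n + 1) (by omega) h₃ (by omega) (by omega)
  have hPq (j : ℕ) (h₂ : n + 2 ≤ j) (h₃ : j ≤ k - 1) : Commute (P.q j) (P.p (n + 1)) :=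
    P.q_p j (n + 1) (by omega) h₃ (by omega) (by omega) (by omega) (by omega)
  have hrq (j : ℕ) (h₂ : n + 2 ≤ j) (h₃ : j ≤ k - 1) : Commute (P.q j) (P.q (n + 1)) :=
    P.q_comm j (n + 1) (by omega) h₃ (by omega) (by omega)
  have has (j : ℕ) (h₂ : n + 3 ≤ j) (h₃ : j ≤ k - 1) : Commute (P.s j) (P.s (n + 1)) :=
    P.s_comm j (n + 1) (by omega) h₃ (by omega) (by omega) (by omega) (by omega)
  have hap' (j : ℕ) (h₂ : n + 3 ≤ j) (h₃ : j ≤ k) : Commute (P.p j) (P.s (n + 1)) :=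
    (P.s_p (n + 1) j (by omega) (by omega) (by omega) h₃ (by omega) (by omega)).symm
  constructor
  · intro j h₂ h₃
    have ht := (h.sigH_s j (by omega) h₃).symm
    have hs := has j h₂ h₃
    have hq := hqs j (by omega) h₃
    rw [h.sigH_succ h₁ hn]
    exact (commute_tauStep_of_far (hbs j (by omega) h₃) ((hs.mul_right ht).mul_right hs) hq
      (h.L_s j (by omega) h₃).symm ((hs.mul_right hq).mul_right hs) ht).symm
  · intro j h₂ h₃
    have ht := (h.sigH_p j (by omega) h₃).symm
    have hs := hap' j h₂ h₃
    have hq := hqp j (by omega) h₃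
    rw [h.sigH_succ h₁ hn]
    exact (commute_tauStep_of_far (hbp j (by omega) h₃) ((hs.mul_right ht).mul_right hs) hq
      (h.L_p j (by omega) h₃).symm ((hs.mul_right hq).mul_right hs) ht).symm
  · intro j h₂ h₃
    have ht := (h.sigH_q j (by omega) h₃).symm
    have hq := hqq j h₂ h₃
    have hb' := hbq j h₂ h₃
    rw [h.sigH_succ h₁ hn]
    refine (commute_tauStep_of_far hb' ?_ hq (h.L_q j (by omega) h₃).symm ?_ ht).symm
    · apply commute_conj ha
      rcases Nat.lt_or_ge j (n + 3) with h₄ | h₄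
      · obtain rfl : j = n + 1 + 1 := by omega
        rw [← P.conj_q (n + 1) (by omega) h₃]
        have hc := (h.sigH_s (n + 1 + 1) le_rfl h₃).symm
        exact (hc.mul_left htr.symm).mul_left hc
      · have hs : Commute (P.q j) (P.s (n + 1)) :=
          (P.s_q' (n + 1) j (by omega) hn (by omega) h₃ (by omega) (by omega)).symm
        rw [← hs.eq, mul_assoc, ha, mul_one]
        exact ht
    · rw [hg]
      exact (hb'.mul_right (hrq j h₂ h₃)).mul_right hb'
  · intro j h₂ h₃
    rw [L_succ h₁ (by omega)]
    exact (commute_LStep_of_far (hbs j h₂ h₃) (hqs j h₂ h₃) (hPs j h₂ h₃)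
      (h.L_s j (by omega) h₃).symm (h.sigH_s j h₂ h₃).symm).symm
  · intro j h₂ h₃
    rw [L_succ h₁ (by omega)]
    exact (commute_LStep_of_far (hbp j h₂ h₃) (hqp j h₂ h₃) (hPp j h₂ h₃)
      (h.L_p j (by omega) h₃).symm (h.sigH_p j h₂ h₃).symm).symm
  · intro j h₂ h₃
    rw [L_succ h₁ (by omega)]
    exact (commute_LStep_of_far (hbq j h₂ h₃) (hqq j h₂ h₃) (hPq j h₂ h₃)
      (h.L_q j (by omega) h₃).symm (h.sigH_q j (by omega) h₃).symm).symm
  · rw [h.sigH_succ h₁ hn]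
    exact (commute_tauStep ha (P.braid n h₁ hn).symm hL.eq.symm hD.eq h.sigH_s_self.eq).symm
  · intro h₃
    have hc := P.s_sq (n + 2) (by omega) h₃
    rw [h.sigH_succ h₁ hn]
    exact commute_conj_tauStep ha hb hc hg (P.conj_q (n + 1) (by omega) h₃) hqb hqr.symm hra har
      (P.braid (n + 1) (by omega) h₃) (hbs (n + 2) le_rfl h₃).symm (hqs (n + 2) le_rfl h₃).symm
      (h.sigH_s (n + 2) le_rfl h₃) (h.L_s (n + 2) (by omega) h₃) hLr (hqq (n + 2) le_rfl h₃).symm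
      htr hD
  · rw [h.sigH_succ h₁ hn, L_succ h₁ (by omega)]
    exact tauStep_mul ha hb hg hqb hqr.symm hra har (P.sps n h₁ (by omega)) hL.eq.symm hLr.eq.symm
      hap (P.conj_q_mul_p n h₁ hn) hPqP hD.eq h.sigH_s_self.eq htr.eq h.sigH_mul_p
  · rw [h.sigH_succ h₁ hn, L_succ h₁ (by omega)]
    exact mul_tauStep ha hb hg (P.s_q n h₁ (by omega)) hqr.symm hra har (P.sps n h₁ (by omega))
      hL.eq.symm hLP.eq hLr.eq.symm hap (P.conj_q_mul_p n h₁ hn) hPqP hD.eq h.sigH_s_self.eq htr.eq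
      h.p_mul_sigH

end GoodAt

theorem goodAt (P : PartitionAlgebra k A) (n : ℕ) (h₁ : 1 ≤ n) (hn : n ≤ k - 1) : P.GoodAt n := by
  induction n, h₁ using Nat.le_induction with
  | base => exact P.goodAt_one hn
  | succ n h₁ ih => exact (ih (by omega)).succ h₁ hn

end PartitionAlgebra

/-- Lemma 3.5: `s_i s_{i+1} σ_{i+1} s_{i+1} s_i p_{i+1/2}
  = s_{i+1} p_{i+1/2} L_i s_i p_{i+3/2} p_{i+1} p_{i+1/2} = σ_{i+1/2} s_{i+1} p_{i+1/2}`
for `1 ≤ i ≤ k-2`. -/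
theorem partitionAlgebra_lemma_f10 {k : ℕ} (hk : 3 ≤ k) {A : Type*} [Ring A]
    [Algebra (Polynomial ℤ) A] (P : PartitionAlgebra k A) :
    ∀ i, 1 ≤ i → i ≤ k - 2 →
      P.s i * P.s (i + 1) * P.sig (i + 1) * P.s (i + 1) * P.s i * P.q i =
        P.s (i + 1) * P.q i * P.L i * P.s i * P.q (i + 1) * P.p (i + 1) * P.q i ∧
      P.s (i + 1) * P.q i * P.L i * P.s i * P.q (i + 1) * P.p (i + 1) * P.q i =
        P.sigH i * P.s (i + 1) * P.q i := by
  intro i h₁ hi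
  have h := P.goodAt i h₁ (by omega)
  have hn : i + 1 ≤ k - 1 := by omega
  have ha := P.s_sq (i + 1) (by omega) hn
  have hb := P.braid i h₁ hn
  have hbq := P.s_q i h₁ (by omega)
  have hD := (h.sigH_conj hn).eq
  have hmid : P.s (i + 1) * P.q i * P.L i * P.s i * P.q (i + 1) * P.p (i + 1) * P.q i =
      P.sigH i * P.s (i + 1) * P.q i := by
    calc _ = P.s (i + 1) *
          (P.q i * P.L i * P.s i * P.q (i + 1) * P.p (i + 1) * P.q i) := by
          simp only [← mul_assoc]
      _ = _ := by rw [h.q_L_s_q_p_q h₁ hn]; simp only [← mul_assoc, ha, one_mul]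
  have hcomm : P.sigH i * P.s (i + 1) * P.q i =
      P.s (i + 1) * P.q i * P.s (i + 1) * P.sigH i * P.s (i + 1) := by
    rw [hD]; simp only [← mul_assoc, mul_two_of_eq ha, mul_one]
  refine ⟨?_, hmid⟩
  rw [hmid, P.sig_succ_s5 i h₁ (by omega)]
  calc _ = P.s i * P.s (i + 1) * P.s i * P.sigH i * P.s (i + 1) * (P.s i * P.q i) := by
        simp only [← mul_assoc]
    _ = P.s i * P.s (i + 1) * P.s i * (P.sigH i * P.s (i + 1) * P.q i) := by
        rw [hbq]; simp only [← mul_assoc]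
    _ = P.s (i + 1) * (P.s i * P.q i) * P.s (i + 1) * P.sigH i * P.s (i + 1) := by
        rw [hcomm, hb]; simp only [← mul_assoc, mul_two_of_eq ha, mul_one]
    _ = _ := by rw [hbq, hcomm]
end
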